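/- For every probability vector p and all positive reals ε and t, there exist δ = δ(p,ε,t) > 0 and a constant A such that whenever K ≥ (C̄_p + ε)·log N, one has E[exp(t·|E_forward(G,G')|)] ≤ 1 + A·N^{−δ}, where G and G' are the shuffle graphs of two independent p-random sequences of N strings of length K. -/

import Mathlib

open Finset

namespace RiffleShuffle

/-- `phi p t = ∑ i, p i ^ t`. -/
noncomputable def phi {k : ℕ} (p : Fin k → ℝ) (t : ℝ) : ℝ := ∑ i, p i ^ t

/-- `psi p t = - log (phi p t)`. -/
noncomputable def psi {k : ℕ} (p : Fin k → ℝ) (t : ℝ) : ℝ := - Real.log (phi p t)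

/-- The maximal entry of `p`. -/
noncomputable def pmax {k : ℕ} (p : Fin k → ℝ) : ℝ := ⨆ i, p i

/-- The minimal entry of `p`. -/
noncomputable def pmin {k : ℕ} (p : Fin k → ℝ) : ℝ := ⨅ i, p i

/-- `C_p = (3+θ)/(4 ψ_p(2))`, where `θ` is the solution of `φ_p(θ) = φ_p(2)²`. -/
noncomputable def Cmain {k : ℕ} (p : Fin k → ℝ) (θ : ℝ) : ℝ := (3 + θ) / (4 * psi p 2)

/-- `C̃_p = 1/log(1/p_max)`. -/
noncomputable def Ctilde {k : ℕ} (p : Fin k → ℝ) : ℝ := 1 / Real.log (1 / pmax p)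

/-- `C̄_p = max(C̃_p, C_p)`. -/
noncomputable def Cbar {k : ℕ} (p : Fin k → ℝ) (θ : ℝ) : ℝ := max (Ctilde p) (Cmain p θ)

/-- Strings of length `K` over the alphabet `{0,…,k-1}`. -/
abbrev Str (k K : ℕ) := Fin K → Fin k

/-- Probability of an individual string, all digits i.i.d. with law `p`. -/
noncomputable def strP {k : ℕ} (p : Fin k → ℝ) {K : ℕ} (s : Str k K) : ℝ := ∏ j, p (s j)

/-- Probability of a tuple of `N` i.i.d. `p`-random strings. -/
noncomputable def seqP {k : ℕ} (p : Fin k → ℝ) {N K : ℕ} (ω : Fin N → Str k K) : ℝ :=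
  ∏ i, strP p (ω i)

/-- The base-`k` value of a string; comparing these values is exactly the lexicographic
order on strings of the same length. -/
def lexVal {k K : ℕ} (s : Str k K) : ℕ := ∑ j : Fin K, (s j : ℕ) * k ^ (K - 1 - (j : ℕ))

/-- The lexicographically sorted rearrangement of a tuple of strings. -/
noncomputable def sortedSeq {k N K : ℕ} (ω : Fin N → Str k K) : Fin N → Str k K :=
  fun i => ω (Tuple.sort (fun j => lexVal (ω j)) i)

/-- The edge set of the shuffle graph of a (sorted) sequence of strings: the edge between
`i` and `i+1` is present iff `s i = s (i+1)`; edges are recorded as pairs `(i, i+1)`. -/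
def edgeSet {k N K : ℕ} (s : Fin N → Str k K) : Finset (Fin N × Fin N) :=
  univ.filter (fun e => (e.2 : ℕ) = (e.1 : ℕ) + 1 ∧ s e.1 = s e.2)

/-- `s` begins with two digits equal to `d`. -/
def beginsWith2 {k : ℕ} (d : Fin k) {K : ℕ} (s : Str k K) : Prop :=
  ∃ h : 2 ≤ K, s ⟨0, by omega⟩ = d ∧ s ⟨1, by omega⟩ = d

instance {k K : ℕ} (d : Fin k) (s : Str k K) : Decidable (beginsWith2 d s) :=
  exists_prop_decidable _

/-- The edges of the shuffle graph of `s` whose common string does **not** begin with two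
digits equal to `d`.  For `d = k-1` this is `E_forward(G)`, for `d = 0` it is `E_backward(G)`. -/
def edgesAvoiding {k N K : ℕ} (d : Fin k) (s : Fin N → Str k K) : Finset (Fin N × Fin N) :=
  (edgeSet s).filter (fun e => ¬ beginsWith2 d (s e.1))

section SortedSamples

variable {α ι : Type}

/-- Number of samples strictly below `b`. -/
def countLt [Fintype ι] (v : α → ℕ) (ω : ι → α) (b : α) : ℕ := #{j | v (ω j) < v b}

/-- Number of samples weakly below `b`. -/
def countLe [Fintype ι] (v : α → ℕ) (ω : ι → α) (b : α) : ℕ := #{j | v (ω j) ≤ v b}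

/-- After sorting `ω` and placing it at positions `l, l + 1, …`, positions `i` and `i + 1` carry the
same good symbol. -/
def EdgeAt [Fintype ι] (v : α → ℕ) (good : α → Prop) (l : ℕ) (ω : ι → α) (i : ℕ) : Prop :=
  ∃ b, good b ∧ countLt v ω b + l ≤ i ∧ i + 2 ≤ countLe v ω b + l

/-- The weight `w` restricted to symbols at level at least `u`. -/
noncomputable def tailWeight (v : α → ℕ) (w : α → ℝ) (u : ℕ) (a : α) : ℝ :=
  if u ≤ v a then w a else 0

/-- Total weight of the symbols at level at least `u`. -/
noncomputable def tailMass [Fintype α] (v : α → ℕ) (w : α → ℝ) (u : ℕ) : ℝ := ∑ a, tailWeight v w u a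

/-- Total weight of the symbols at level at least `u` and weakly below `b`. -/
noncomputable def midMass [Fintype α] (v : α → ℕ) (w : α → ℝ) (u : ℕ) (b : α) : ℝ :=
  ∑ a, if u ≤ v a ∧ v a ≤ v b then w a else 0

open Classical in
/-- Weight of the samples at level at least `u` having edges at all positions of `I`. -/
noncomputable def edgeWeight [Fintype α] (v : α → ℕ) (w : α → ℝ) (good : α → Prop) (ι : Type) [Fintype ι]
    (u l : ℕ) (I : Finset ℕ) : ℝ :=
  ∑ ω : ι → α, (∏ j, tailWeight v w u (ω j)) * if ∀ i ∈ I, EdgeAt v good l ω i then 1 else 0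

theorem tailWeight_nonneg {v : α → ℕ} {w : α → ℝ} (hw : ∀ a, 0 ≤ w a) (u : ℕ) (a : α) :
    0 ≤ tailWeight v w u a := by
  unfold tailWeight; split_ifs <;> simp [hw]

theorem midMass_nonneg [Fintype α] {v : α → ℕ} {w : α → ℝ} (hw : ∀ a, 0 ≤ w a) (u : ℕ) (b : α) :
    0 ≤ midMass v w u b :=
  sum_nonneg fun a _ => by split_ifs <;> simp [hw]

theorem tailMass_nonneg [Fintype α] {v : α → ℕ} {w : α → ℝ} (hw : ∀ a, 0 ≤ w a) (u : ℕ) :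
    0 ≤ tailMass v w u :=
  sum_nonneg fun a _ => tailWeight_nonneg hw u a

theorem edgeWeight_nonneg [Fintype α] [Fintype ι] {v : α → ℕ} {w : α → ℝ} {good : α → Prop} (hw : ∀ a, 0 ≤ w a)
    (u l : ℕ) (I : Finset ℕ) : 0 ≤ edgeWeight v w good ι u l I :=
  sum_nonneg fun ω _ => mul_nonneg (prod_nonneg fun j _ => tailWeight_nonneg hw u _)
    (by split_ifs <;> simp)

theorem edgeWeight_eq [Fintype α] [Fintype ι] [DecidableEq ι] (v : α → ℕ) (w : α → ℝ)
    (good : α → Prop) (u l : ℕ) (I : Finset ℕ) [∀ ω : ι → α, Decidable (∀ i ∈ I, EdgeAt v good l ω i)] :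
    edgeWeight v w good ι u l I = ∑ ω : ι → α, (∏ j, tailWeight v w u (ω j)) *
      if ∀ i ∈ I, EdgeAt v good l ω i then 1 else 0 := by
  unfold edgeWeight
  congr!

theorem edgeWeight_empty [Fintype α] [Fintype ι] (v : α → ℕ) (w : α → ℝ) (good : α → Prop) (u l : ℕ) :
    edgeWeight v w good ι u l ∅ = tailMass v w u ^ Fintype.card ι := by
  classical
  simp only [edgeWeight, notMem_empty, false_imp_iff, implies_true, if_true, mul_one, tailMass]
  rw [← Finset.card_univ, ← prod_const, prod_univ_sum, Fintype.piFinset_univ]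

theorem sum_prod_mul_restrict [Fintype α] [Fintype ι] [DecidableEq ι] (P : ι → Prop) [DecidablePred P] (h : ι → α → ℝ)
    (g : ({j // ¬ P j} → α) → ℝ) :
    ∑ ω : ι → α, (∏ j, h j (ω j)) * g (fun j => ω j.1) =
      (∏ j : {j // P j}, ∑ a, h j a) *
        ∑ ω : {j // ¬ P j} → α, (∏ j : {j // ¬ P j}, h j (ω j)) * g ω := by
  classical
  rw [← (Equiv.piEquivPiSubtypeProd P (fun _ => α)).symm.sum_comp, Fintype.sum_prod_type,
    prod_univ_sum, ← Fintype.piFinset_univ, sum_mul]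
  refine sum_congr rfl fun ω₁ _ => ?_
  rw [mul_sum]
  refine sum_congr rfl fun ω₂ _ => ?_
  rw [← Fintype.prod_subtype_mul_prod_subtype P, mul_assoc]
  congr 1
  · refine prod_congr rfl fun j _ => ?_
    simp [Equiv.piEquivPiSubtypeProd, j.2]
  · congr 1
    · refine prod_congr rfl fun j _ => ?_
      simp [Equiv.piEquivPiSubtypeProd, j.2]
    · congr 1
      funext j
      simp [Equiv.piEquivPiSubtypeProd, j.2]

/-- Ways to choose an ordered pair of samples together with `j` further samples. -/
def splittings (ι : Type) [Fintype ι] [DecidableEq ι] (j : ℕ) : Finset (Σ _ : ι × ι, Finset ι) :=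
  (univ : Finset ι).offDiag.sigma fun xy => powersetCard j (univ \ {xy.1, xy.2})

theorem card_splittings [Fintype ι] [DecidableEq ι] (j : ℕ) :
    #(splittings ι j) =
      (Fintype.card ι * Fintype.card ι - Fintype.card ι) * (Fintype.card ι - 2).choose j := by
  rw [splittings, card_sigma, sum_congr rfl (g := fun _ => (Fintype.card ι - 2).choose j),
    sum_const, offDiag_card, smul_eq_mul, card_univ]
  rintro ⟨x, y⟩ hxy
  have hne : x ≠ y := by simpa using hxy
  rw [card_powersetCard, card_sdiff_of_subset (subset_univ _), card_pair hne, card_univ]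

theorem exists_splitting [Fintype ι] [DecidableEq ι] {v : α → ℕ} {good : α → Prop}
    (hv : Function.Injective v) {l i : ℕ} {I : Finset ℕ} (hI : ∀ i' ∈ I, i + 2 ≤ i')
    (hli : l ≤ i) (ω : ι → α) (hi : EdgeAt v good l ω i) (hE : ∀ i' ∈ I, EdgeAt v good l ω i') :
    ∃ b, good b ∧ ∃ τ ∈ splittings ι (i - l), ω τ.1.1 = b ∧ ω τ.1.2 = b ∧
      (∀ j ∈ τ.2, v (ω j) ≤ v b) ∧
      (∀ j, j ∉ insert τ.1.1 (insert τ.1.2 τ.2) → v b ≤ v (ω j)) ∧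
      ∀ i' ∈ I, EdgeAt v good (i + 2)
        (fun j : {j // ¬ j ∈ insert τ.1.1 (insert τ.1.2 τ.2)} => ω j.1) i' := by
  obtain ⟨b, hb, h1, h2⟩ := hi
  unfold countLt at h1
  unfold countLe at h2
  obtain ⟨D, hAD, hDH, hD⟩ := exists_subsuperset_card_eq
    (s := ({j | v (ω j) < v b} : Finset ι)) (t := ({j | v (ω j) ≤ v b} : Finset ι)) (n := i - l)
    (by intro j; simp only [mem_filter_univ]; omega) (by omega) (by omega)
  have hcard : 1 < #(({j | v (ω j) ≤ v b} : Finset ι) \ D) := by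
    rw [card_sdiff_of_subset hDH]; omega
  obtain ⟨x, hx, y, hy, hxy⟩ := one_lt_card.1 hcard
  have hDle : ∀ j ∈ D, v (ω j) ≤ v b := fun j hj => by simpa using hDH hj
  have hlt : ∀ j, v (ω j) < v b → j ∈ D := fun j hj => hAD (by simpa using hj)
  have heq : ∀ z ∈ ({j | v (ω j) ≤ v b} : Finset ι) \ D, ω z = b := by
    intro z hz
    rw [mem_sdiff, mem_filter_univ] at hz
    refine hv (le_antisymm hz.1 ?_)
    by_contra hcon
    exact hz.2 (hlt z (by omega))
  have hxD := (mem_sdiff.1 hx).2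
  have hyD := (mem_sdiff.1 hy).2
  have hPcard : #(insert x (insert y D)) = i - l + 2 := by
    rw [card_insert_of_notMem (by simp [hxy, hxD]), card_insert_of_notMem hyD, hD]
  refine ⟨b, hb, ⟨(x, y), D⟩, ?_, heq x hx, heq y hy, hDle, ?_, ?_⟩
  · simp only [splittings, mem_sigma, mem_offDiag, mem_univ, true_and, mem_powersetCard]
    refine ⟨hxy, ?_, hD⟩
    intro j hj
    simp only [mem_sdiff, mem_univ, true_and, mem_insert, mem_singleton, not_or]
    exact ⟨fun h => hxD (h ▸ hj), fun h => hyD (h ▸ hj)⟩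
  · intro j hj
    by_contra hcon
    exact hj (by simp [hlt j (by omega)])
  · dsimp only
    intro i' hi'
    obtain ⟨b', hb', h1', h2'⟩ := hE i' hi'
    have hii := hI i' hi'
    have hPle : ∀ j ∈ insert x (insert y D), v (ω j) ≤ v b := by
      intro j hj
      simp only [mem_insert] at hj
      rcases hj with rfl | rfl | hj
      · exact (congrArg v (heq _ hx)).le
      · exact (congrArg v (heq _ hy)).le
      · exact hDle j hj
    have hsplit : ∀ q : ℕ → Prop, ∀ [DecidablePred q], (∀ n ≤ v b, q n) →
        #{j | q (v (ω j))} = i - l + 2 +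
          #{j : {j // ¬ j ∈ insert x (insert y D)} | q (v (ω j.1))} := by
      intro q _ hq
      rw [← hPcard, ← card_filter_add_card_filter_not (s := ({j | q (v (ω j))} : Finset ι))
        (fun j => j ∈ insert x (insert y D))]
      congr 1
      · congr 1
        ext j
        simp only [mem_filter, mem_univ, true_and]
        exact ⟨fun h => h.2, fun h => ⟨hq _ (hPle j h), h⟩⟩
      · rw [← card_map (Function.Embedding.subtype _)]
        congr 1
        ext j
        simp only [mem_filter, mem_univ, true_and, mem_map, Function.Embedding.subtype_apply,
          Subtype.exists, exists_and_left, exists_prop, exists_eq_right_right]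
    have hbb : v b ≤ v b' := by
      by_contra hcon
      have : #({j | v (ω j) ≤ v b'} : Finset ι) ≤ #({j | v (ω j) < v b} : Finset ι) := by
        refine card_le_card fun j => ?_
        simp only [mem_filter_univ]
        omega
      unfold countLe at h2'
      omega
    refine ⟨b', hb', ?_, ?_⟩
    · rcases hbb.lt_or_eq with hlt' | heq'
      · have := hsplit (fun n => n < v b') (fun n hn => by omega)
        simp only [countLt] at h1' this ⊢
        omega
      · have : countLt v (fun j : {j // ¬ j ∈ insert x (insert y D)} => ω j.1) b' = 0 := by
          unfold countLt
          rw [card_eq_zero, filter_eq_empty_iff]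
          rintro ⟨j, hj⟩ -
          rw [← heq']
          intro hcon
          exact hj (by simp [hlt j hcon])
        omega
    · have := hsplit (fun n => n ≤ v b') (fun n hn => by omega)
      simp only [countLe] at h2' this ⊢
      omega

/-- The set of samples used by a splitting. -/
def usedSamples [DecidableEq ι] (τ : Σ _ : ι × ι, Finset ι) : Finset ι :=
  insert τ.1.1 (insert τ.1.2 τ.2)

theorem card_usedSamples [Fintype ι] [DecidableEq ι] {j : ℕ} {τ : Σ _ : ι × ι, Finset ι}
    (hτ : τ ∈ splittings ι j) : #(usedSamples τ) = j + 2 := by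
  obtain ⟨⟨x, y⟩, D⟩ := τ
  simp only [splittings, mem_sigma, mem_offDiag, mem_univ, true_and, mem_powersetCard] at hτ
  obtain ⟨hxy, hD, hj⟩ := hτ
  have hx : x ∉ D := fun h => by simpa using hD h
  have hy : y ∉ D := fun h => by simpa using hD h
  rw [usedSamples, card_insert_of_notMem (by simp [hxy, hx]), card_insert_of_notMem hy, hj]

open Classical in
/-- The weight forced by a splitting at symbol `b`: the distinguished pair takes the value `b`, the
chosen samples lie weakly below `b`, all the others weakly above. -/
noncomputable def splitWeight (v : α → ℕ) (w : α → ℝ) (u : ℕ) (b : α)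
    (τ : Σ _ : ι × ι, Finset ι) (j : ι) (a : α) : ℝ :=
  if j = τ.1.1 ∨ j = τ.1.2 then (if a = b then w a else 0)
  else if j ∈ τ.2 then (if u ≤ v a ∧ v a ≤ v b then w a else 0)
  else tailWeight v w (v b) a

theorem splitWeight_nonneg {v : α → ℕ} {w : α → ℝ} (hw : ∀ a, 0 ≤ w a) (u : ℕ) (b : α)
    (τ : Σ _ : ι × ι, Finset ι) (j : ι) (a : α) : 0 ≤ splitWeight v w u b τ j a := by
  unfold splitWeight
  split_ifs <;> simp [hw, tailWeight_nonneg hw]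

theorem prod_splitWeight [Fintype α] [Fintype ι] [DecidableEq ι] {v : α → ℕ} {w : α → ℝ} (u : ℕ)
    (b : α) {i : ℕ} {τ : Σ _ : ι × ι, Finset ι} (hτ : τ ∈ splittings ι i) :
    ∏ j : {j // j ∈ usedSamples τ}, ∑ a, splitWeight v w u b τ j a =
      w b ^ 2 * midMass v w u b ^ i := by
  classical
  obtain ⟨⟨x, y⟩, D⟩ := τ
  simp only [splittings, mem_sigma, mem_offDiag, mem_univ, true_and, mem_powersetCard] at hτ
  obtain ⟨hxy, hD, hj⟩ := hτ
  have hx : x ∉ D := fun h => by simpa using hD h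
  have hy : y ∉ D := fun h => by simpa using hD h
  rw [prod_coe_sort (usedSamples _) (fun j => ∑ a, splitWeight v w u b ⟨(x, y), D⟩ j a),
    usedSamples, prod_insert (by simp [hxy, hx]), prod_insert hy]
  have hrest : ∀ j ∈ D, ∑ a, splitWeight v w u b ⟨(x, y), D⟩ j a = midMass v w u b := by
    intro j hjD
    have h1 : j ≠ x := fun h => hx (h ▸ hjD)
    have h2 : j ≠ y := fun h => hy (h ▸ hjD)
    simp [splitWeight, midMass, h1, h2, hjD]
  rw [prod_congr rfl hrest, prod_const, hj]
  simp [splitWeight]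
  ring

theorem edgeWeight_insert_le [Fintype α] [Fintype ι] [DecidableEq ι] {v : α → ℕ} {w : α → ℝ}
    {good : α → Prop} [DecidablePred good] (hw : ∀ a, 0 ≤ w a) (hv : Function.Injective v)
    {u l i : ℕ} {I : Finset ℕ} (hI : ∀ i' ∈ I, i + 2 ≤ i') (hli : l ≤ i) :
    edgeWeight v w good ι u l (insert i I) ≤
      ∑ x ∈ ({b | good b ∧ u ≤ v b} : Finset α) ×ˢ splittings ι (i - l),
        w x.1 ^ 2 * midMass v w u x.1 ^ (i - l) *
          edgeWeight v w good {j // ¬ j ∈ usedSamples x.2} (v x.1) (i + 2) I := by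
  classical
  have hrw : ∀ x ∈ ({b | good b ∧ u ≤ v b} : Finset α) ×ˢ splittings ι (i - l),
      w x.1 ^ 2 * midMass v w u x.1 ^ (i - l) *
          edgeWeight v w good {j // ¬ j ∈ usedSamples x.2} (v x.1) (i + 2) I =
        ∑ ω : ι → α, (∏ j, splitWeight v w u x.1 x.2 j (ω j)) *
          if ∀ i' ∈ I, EdgeAt v good (i + 2) (fun j : {j // ¬ j ∈ usedSamples x.2} => ω j.1) i'
          then 1 else 0 := by
    rintro ⟨b, τ⟩ hx
    have hτ : τ ∈ splittings ι (i - l) := (mem_product.1 hx).2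
    dsimp only
    rw [sum_prod_mul_restrict (fun j => j ∈ usedSamples τ) (splitWeight v w u b τ)
      (fun ω => if ∀ i' ∈ I, EdgeAt v good (i + 2) ω i' then 1 else 0),
      ← prod_splitWeight u b hτ, edgeWeight_eq]
    congr 1
    · congr!
    refine sum_congr rfl fun ω _ => ?_
    congr 1
    refine prod_congr rfl fun j _ => ?_
    have hj := j.2
    simp only [usedSamples, mem_insert, not_or] at hj
    simp [splitWeight, hj]
  rw [sum_congr rfl hrw, sum_comm, edgeWeight_eq]
  refine sum_le_sum fun ω _ => ?_
  have hterm : ∀ x ∈ ({b | good b ∧ u ≤ v b} : Finset α) ×ˢ splittings ι (i - l),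
      0 ≤ (∏ j, splitWeight v w u x.1 x.2 j (ω j)) *
          if ∀ i' ∈ I, EdgeAt v good (i + 2) (fun j : {j // ¬ j ∈ usedSamples x.2} => ω j.1) i'
          then (1 : ℝ) else 0 := fun x _ =>
    mul_nonneg (prod_nonneg fun j _ => splitWeight_nonneg hw _ _ _ _ _) (by split_ifs <;> simp)
  by_cases hE : ∀ i' ∈ insert i I, EdgeAt v good l ω i'
  swap
  · rw [if_neg hE, mul_zero]
    exact sum_nonneg hterm
  rw [if_pos hE, mul_one]
  by_cases hu : ∀ j, u ≤ v (ω j)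
  swap
  · push Not at hu
    obtain ⟨j, hj⟩ := hu
    rw [prod_eq_zero (mem_univ j) (by simp [tailWeight, hj])]
    exact sum_nonneg hterm
  obtain ⟨b, hb, τ, hτ, h1, h2, h3, h4, h5⟩ := exists_splitting hv hI hli ω
    (hE i (mem_insert_self _ _)) (fun i' hi' => hE i' (mem_insert_of_mem hi'))
  refine le_trans (le_of_eq ?_) (single_le_sum hterm (a := (b, τ)) ?_)
  · have h6 : ∀ i' ∈ I, EdgeAt v good (i + 2)
        (fun j : {j // ¬ j ∈ usedSamples τ} => ω j.1) i' := h5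
    dsimp only
    rw [if_pos h6, mul_one]
    refine prod_congr rfl fun j _ => ?_
    unfold splitWeight
    split_ifs with h6 h7 h8 h9
    · simp [tailWeight, hu]
    · exfalso; rcases h6 with rfl | rfl <;> contradiction
    · simp [tailWeight, hu]
    · exact absurd ⟨hu j, h3 j h8⟩ h9
    · have := h4 j (by simp only [mem_insert]; tauto)
      simp [tailWeight, hu, this]
  · simp only [mem_product, mem_filter_univ]
    exact ⟨⟨hb, h1 ▸ hu _⟩, hτ⟩

theorem sum_powerset_eq_min (S : Finset ℕ) (f : Finset ℕ → ℝ) :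
    ∑ I ∈ S.powerset, f I =
      f ∅ + ∑ i ∈ S, ∑ I ∈ (S.filter (i < ·)).powerset, f (insert i I) := by
  induction S using Finset.induction_on_min with
  | empty => simp
  | insert a s ha ih =>
    have has : a ∉ s := fun h => lt_irrefl _ (ha a h)
    rw [sum_powerset_insert has, ih, sum_insert has, filter_insert, if_neg (lt_irrefl a),
      filter_true_of_mem ha, add_assoc, add_comm (∑ i ∈ s, _)]
    congr 2
    refine sum_congr rfl fun i hi => ?_
    rw [filter_insert, if_neg (not_lt.2 (ha i hi).le)]

theorem edgeWeight_sq_sum_le {v : α → ℕ} {w : α → ℝ} {good : α → Prop} [Fintype α]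
    [DecidablePred good] (hw : ∀ a, 0 ≤ w a) (hv : Function.Injective v)
    (hpos : ∀ b, good b → 0 < tailMass v w (v b)) {R : ℕ → Prop} [DecidablePred R]
    (hR : ∀ i, R i → ¬ R (i + 1)) {c Q : ℝ} (hc : 0 ≤ c) (hQ0 : 0 ≤ Q) (hQ : Q ≤ 1 / 2) {N : ℕ}
    {okLevel : ℕ → Prop} (hok : ∀ b, good b → okLevel (v b))
    (H : ∀ u m, okLevel u → m + 2 ≤ N →
      c * ∑ j ∈ range (m + 1), (∑ b with good b ∧ u ≤ v b, (m + 2 : ℝ) ^ 2 * m.choose j *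
        (w b ^ 2 * midMass v w u b ^ j * tailMass v w (v b) ^ (m - j))) ^ 2 ≤
      Q * tailMass v w u ^ (2 * (m + 2)))
    (n : ℕ) (hn : n ≤ N) (ι : Type) [Fintype ι] (hι : Fintype.card ι = n) (u l : ℕ)
    (hu : okLevel u) :
    ∑ I ∈ ((Ico l (l + n)).filter R).powerset, c ^ #I * edgeWeight v w good ι u l I ^ 2 ≤
      tailMass v w u ^ (2 * n) * (1 + 2 * Q) := by
  classical
  induction n using Nat.strong_induction_on generalizing ι u l with
  | _ n ih =>
  set S := (Ico l (l + n)).filter R with hS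
  rw [sum_powerset_eq_min, edgeWeight_empty, hι, card_empty, pow_zero, one_mul, ← pow_mul,
    mul_comm n 2, mul_add, mul_one]
  gcongr
  set p : ℕ → ℝ := fun j => ∑ x ∈ ({b | good b ∧ u ≤ v b} : Finset α) ×ˢ splittings ι j,
    w x.1 ^ 2 * midMass v w u x.1 ^ j * tailMass v w (v x.1) ^ (n - 2 - j) with hp
  have hstep : ∀ i ∈ S, ∑ I ∈ (S.filter (i < ·)).powerset,
      c ^ #(insert i I) * edgeWeight v w good ι u l (insert i I) ^ 2 ≤
      c * p (i - l) ^ 2 * (1 + 2 * Q) := by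
    intro i hi
    obtain ⟨hil, hRi⟩ := mem_filter.1 hi
    rw [mem_Ico] at hil
    have hsub : ∀ I ∈ (S.filter (i < ·)).powerset, ∀ i' ∈ I, i + 2 ≤ i' := by
      intro I hI i' hi'
      have := mem_powerset.1 hI hi'
      simp only [hS, mem_filter] at this
      have h1 : i' ≠ i + 1 := by
        rintro rfl
        exact hR i hRi this.1.2
      omega
    have hCS : ∀ I ∈ (S.filter (i < ·)).powerset,
        c ^ #(insert i I) * edgeWeight v w good ι u l (insert i I) ^ 2 ≤
          c * p (i - l) * ∑ x ∈ ({b | good b ∧ u ≤ v b} : Finset α) ×ˢ splittings ι (i - l),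
            w x.1 ^ 2 * midMass v w u x.1 ^ (i - l) / tailMass v w (v x.1) ^ (n - 2 - (i - l)) *
            (c ^ #I * edgeWeight v w good {j // ¬ j ∈ usedSamples x.2} (v x.1) (i + 2) I ^ 2) := by
      intro I hI
      have hiI : i ∉ I := fun h => by have := hsub I hI i h; omega
      rw [card_insert_of_notMem hiI, pow_succ']
      have h1 := edgeWeight_insert_le (ι := ι) (good := good) (u := u) hw hv (hsub I hI) hil.1
      have h2 := pow_le_pow_left₀ (edgeWeight_nonneg hw _ _ _) h1 2
      have h3 := h2.trans (sum_sq_le_sum_mul_sum_of_sq_le_mul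
        (({b | good b ∧ u ≤ v b} : Finset α) ×ˢ splittings ι (i - l))
        (f := fun x => w x.1 ^ 2 * midMass v w u x.1 ^ (i - l) *
          tailMass v w (v x.1) ^ (n - 2 - (i - l)))
        (g := fun x => w x.1 ^ 2 * midMass v w u x.1 ^ (i - l) /
          tailMass v w (v x.1) ^ (n - 2 - (i - l)) *
          edgeWeight v w good {j // ¬ j ∈ usedSamples x.2} (v x.1) (i + 2) I ^ 2)
        (fun x _ => mul_nonneg (mul_nonneg (sq_nonneg _) (pow_nonneg (midMass_nonneg hw _ _) _))
          (pow_nonneg (tailMass_nonneg hw _) _))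
        (fun x _ => mul_nonneg (div_nonneg (mul_nonneg (sq_nonneg _)
          (pow_nonneg (midMass_nonneg hw _ _) _)) (pow_nonneg (tailMass_nonneg hw _) _))
          (sq_nonneg _))
        (fun x hx => by
          have hb : good x.1 := by
            have := (mem_product.1 hx).1
            rw [mem_filter_univ] at this
            exact this.1
          have := (pow_pos (hpos x.1 hb) (n - 2 - (i - l))).ne'
          refine le_of_eq ?_
          field_simp))
      calc c * c ^ #I * edgeWeight v w good ι u l (insert i I) ^ 2
          ≤ c * c ^ #I * _ := mul_le_mul_of_nonneg_left h3 (by positivity)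
        _ = _ := by
          rw [show ∀ a b d e : ℝ, a * b * (d * e) = a * d * (b * e) by intros; ring]
          congr 1
          rw [mul_sum]
          exact sum_congr rfl fun x _ => by ring
    refine (sum_le_sum hCS).trans ?_
    rw [← mul_sum, sum_comm, show c * p (i - l) ^ 2 * (1 + 2 * Q) =
      c * p (i - l) * (p (i - l) * (1 + 2 * Q)) by ring]
    have hp0 : 0 ≤ p (i - l) := sum_nonneg fun x _ => mul_nonneg (mul_nonneg (sq_nonneg _)
      (pow_nonneg (midMass_nonneg hw _ _) _)) (pow_nonneg (tailMass_nonneg hw _) _)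
    refine mul_le_mul_of_nonneg_left ?_ (mul_nonneg hc hp0)
    rw [hp, sum_mul]
    refine sum_le_sum fun x hx => ?_
    obtain ⟨hb, hτ⟩ := mem_product.1 hx
    rw [mem_filter_univ] at hb
    have hcard : Fintype.card {j // ¬ j ∈ usedSamples x.2} = n - 2 - (i - l) := by
      rw [Fintype.card_subtype_compl, hι, Fintype.card_coe, card_usedSamples hτ]
      omega
    have hle : i - l + 2 ≤ n := by
      rw [← hι, ← card_usedSamples hτ]
      exact card_le_univ _
    have hIH := ih (n - 2 - (i - l)) (by omega) (by omega) _ hcard (v x.1) (i + 2) (hok _ hb.1)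
    have hS' : S.filter (i < ·) = (Ico (i + 2) (i + 2 + (n - 2 - (i - l)))).filter R := by
      ext i'
      simp only [hS, mem_filter, mem_Ico]
      constructor
      · rintro ⟨⟨⟨h1, h2⟩, h3⟩, h4⟩
        have : i' ≠ i + 1 := by
          rintro rfl
          exact hR i hRi h3
        exact ⟨by omega, h3⟩
      · rintro ⟨⟨h1, h2⟩, h3⟩
        exact ⟨⟨by omega, h3⟩, by omega⟩
    rw [← mul_sum, hS', div_mul_eq_mul_div, mul_assoc, mul_assoc, mul_assoc, mul_div_assoc,
      mul_div_assoc]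
    have h0 := pow_pos (hpos x.1 hb.1) (n - 2 - (i - l))
    refine mul_le_mul_of_nonneg_left (mul_le_mul_of_nonneg_left ?_
      (pow_nonneg (midMass_nonneg hw _ _) _)) (sq_nonneg _)
    rw [div_le_iff₀ h0]
    refine hIH.trans (le_of_eq ?_)
    ring
  refine (sum_le_sum hstep).trans ?_
  have hbd : ∑ i ∈ S, c * p (i - l) ^ 2 * (1 + 2 * Q) ≤
      c * (∑ j ∈ range n, p j ^ 2) * (1 + 2 * Q) := by
    rw [← sum_mul, ← mul_sum]
    refine mul_le_mul_of_nonneg_right (mul_le_mul_of_nonneg_left ?_ hc) (by linarith)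
    refine (sum_le_sum_of_subset_of_nonneg (filter_subset _ _)
      fun _ _ _ => sq_nonneg _).trans (le_of_eq ?_)
    rw [sum_Ico_eq_sum_range]
    simp
  refine hbd.trans ?_
  have hW : 0 ≤ tailMass v w u ^ (2 * n) := pow_nonneg (tailMass_nonneg hw _) _
  have hpj : ∀ j, p j ≤ (#(splittings ι j) : ℝ) * ∑ b with good b ∧ u ≤ v b,
      w b ^ 2 * midMass v w u b ^ j * tailMass v w (v b) ^ (n - 2 - j) := by
    intro j
    simp only [hp]
    rw [sum_product, mul_sum]
    exact le_of_eq (sum_congr rfl fun b _ => by simp)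
  have hp0 : ∀ j, 0 ≤ p j := fun j => sum_nonneg fun x _ => mul_nonneg (mul_nonneg (sq_nonneg _)
      (pow_nonneg (midMass_nonneg hw _ _) _)) (pow_nonneg (tailMass_nonneg hw _) _)
  have hzero : ∀ j, #(splittings ι j) = 0 → p j = 0 := fun j hj => by
    have := hpj j
    rw [hj, Nat.cast_zero, zero_mul] at this
    exact le_antisymm this (hp0 j)
  have hmain : c * ∑ j ∈ range n, p j ^ 2 ≤ Q * tailMass v w u ^ (2 * n) := by
    rcases Nat.lt_or_ge n 2 with h2 | h2
    · rw [sum_eq_zero, mul_zero]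
      · positivity
      · intro j _
        rw [hzero, zero_pow two_ne_zero]
        rw [card_splittings, hι]
        interval_cases n <;> simp
    · obtain ⟨m, rfl⟩ := Nat.exists_eq_add_of_le' h2
      refine le_trans (mul_le_mul_of_nonneg_left ?_ hc) (H u m hu hn)
      rw [sum_range_succ, hzero (m + 1) (by rw [card_splittings, hι]; simp)]
      rw [zero_pow two_ne_zero, add_zero]
      refine sum_le_sum fun j _ => pow_le_pow_left₀ (hp0 j) ((hpj j).trans ?_) 2
      rw [← mul_sum]
      refine mul_le_mul_of_nonneg_right ?_ (sum_nonneg fun x _ => mul_nonneg (mul_nonneg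
        (sq_nonneg _) (pow_nonneg (midMass_nonneg hw _ _) _))
        (pow_nonneg (tailMass_nonneg hw _) _))
      rw [card_splittings, hι]
      have : (((m + 2) * (m + 2) - (m + 2) : ℕ) : ℝ) ≤ (m + 2 : ℝ) ^ 2 := by
        refine (Nat.cast_le.2 (Nat.sub_le _ _)).trans (le_of_eq ?_)
        push_cast
        ring
      push_cast at this ⊢
      exact mul_le_mul_of_nonneg_right this (Nat.cast_nonneg _)
  calc c * (∑ j ∈ range n, p j ^ 2) * (1 + 2 * Q)
      ≤ Q * tailMass v w u ^ (2 * n) * 2 := by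
        refine mul_le_mul hmain (by linarith) (by linarith) (mul_nonneg hQ0 hW)
    _ = tailMass v w u ^ (2 * n) * (2 * Q) := by ring

end SortedSamples

theorem lexVal_cons {k K : ℕ} (i : Fin k) (s : Str k K) :
    lexVal (Fin.cons i s : Str k (K + 1)) = i * k ^ K + lexVal s := by
  simp only [lexVal, Fin.sum_univ_succ, Fin.cons_zero, Fin.cons_succ, Fin.val_zero, Fin.val_succ]
  congr 1
  refine sum_congr rfl fun j _ => ?_
  congr 2
  omega

theorem lexVal_lt {k K : ℕ} (s : Str k K) : lexVal s < k ^ K := by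
  induction K with
  | zero => simp [lexVal]
  | succ K ih =>
    rw [← Fin.cons_self_tail s, lexVal_cons, pow_succ']
    have h1 := ih (Fin.tail s)
    calc (s 0 : ℕ) * k ^ K + lexVal (Fin.tail s) < s 0 * k ^ K + k ^ K := by omega
      _ = (s 0 + 1) * k ^ K := by ring
      _ ≤ k * k ^ K := Nat.mul_le_mul_right _ (s 0).isLt

theorem lexVal_cons_lt_cons {k K : ℕ} {i i' : Fin k} (h : i < i') (s s' : Str k K) :
    lexVal (Fin.cons i s : Str k (K + 1)) < lexVal (Fin.cons i' s' : Str k (K + 1)) := by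
  rw [lexVal_cons, lexVal_cons]
  have h1 := lexVal_lt s
  have h2 : (i + 1 : ℕ) * k ^ K ≤ i' * k ^ K := Nat.mul_le_mul_right _ h
  rw [add_mul] at h2
  omega

theorem lexVal_injective {k K : ℕ} : Function.Injective (lexVal : Str k K → ℕ) := by
  induction K with
  | zero => exact fun s s' _ => Subsingleton.elim _ _
  | succ K ih =>
    intro s s' h
    rw [← Fin.cons_self_tail s, ← Fin.cons_self_tail s'] at h ⊢
    rcases lt_trichotomy (s 0) (s' 0) with h0 | h0 | h0
    · exact absurd h (lexVal_cons_lt_cons h0 _ _).ne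
    · rw [h0, lexVal_cons, lexVal_cons] at h
      rw [h0, ih (Nat.add_left_cancel h)]
    · exact absurd h (lexVal_cons_lt_cons h0 _ _).ne'

theorem edgeAt_of_mem_edgesAvoiding {k N K : ℕ} {d : Fin k} {ω : Fin N → Str k K}
    {e : Fin N × Fin N} (he : e ∈ edgesAvoiding d (sortedSeq ω)) :
    EdgeAt lexVal (fun b : Str k K => ¬ beginsWith2 d b) 0 ω e.1 := by
  simp only [edgesAvoiding, edgeSet, mem_filter, mem_univ, true_and] at he
  obtain ⟨⟨h1, h2⟩, h3⟩ := he
  set σ := Tuple.sort (fun j => lexVal (ω j)) with hσ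
  have hmono : ∀ i j, i ≤ j → lexVal (ω (σ i)) ≤ lexVal (ω (σ j)) :=
    fun i j h => Tuple.monotone_sort (fun j => lexVal (ω j)) h
  have hb : lexVal (ω (σ e.1)) = lexVal (ω (σ e.2)) := congrArg lexVal h2
  refine ⟨sortedSeq ω e.1, h3, ?_, ?_⟩
  · rw [add_zero, ← Fin.card_Iio e.1]
    refine card_le_card_of_injOn σ.symm (fun j hj => ?_) σ.symm.injective.injOn
    rw [mem_coe, mem_filter_univ] at hj
    rw [mem_coe, mem_Iio]
    by_contra hcon
    have := hmono _ _ (not_lt.1 hcon)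
    rw [Equiv.apply_symm_apply] at this
    exact absurd hj (not_lt.2 this)
  · rw [add_zero]
    have hc : #(Iic e.2) = e.1 + 2 := by rw [Fin.card_Iic, h1]
    rw [← hc]
    refine card_le_card_of_injOn σ (fun j hj => ?_) σ.injective.injOn
    rw [mem_coe, mem_Iic] at hj
    rw [mem_coe, mem_filter_univ]
    exact (hmono _ _ hj).trans hb.ge

theorem one_add_pow_card_eq_sum_powerset (T : Finset ℕ) (c : ℝ) :
    (1 + c) ^ #T = ∑ I ∈ T.powerset, c ^ #I := by
  rw [add_comm, ← sum_pow_mul_eq_add_pow c 1 T]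
  simp

open Classical in
theorem exp_card_edges_le {k N K : ℕ} (d : Fin k) (ω ω' : Fin N → Str k K) {t : ℝ} (ht : 0 < t) :
    Real.exp (t * (#(edgesAvoiding d (sortedSeq ω) ∩ edgesAvoiding d (sortedSeq ω')) : ℝ)) ≤
      ∑ r : Fin 2, 1 / 2 * ∑ I ∈ ((Ico 0 (0 + N)).filter (fun i => i % 2 = (r : ℕ))).powerset,
        (Real.exp (2 * t) - 1) ^ #I *
          ((if ∀ i ∈ I, EdgeAt lexVal (fun b : Str k K => ¬ beginsWith2 d b) 0 ω i then 1 else 0) *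
          (if ∀ i ∈ I, EdgeAt lexVal (fun b : Str k K => ¬ beginsWith2 d b) 0 ω' i
            then 1 else 0)) := by
  set T : Finset ℕ := (Ico 0 (0 + N)).filter fun i =>
    EdgeAt lexVal (fun b : Str k K => ¬ beginsWith2 d b) 0 ω i ∧
    EdgeAt lexVal (fun b : Str k K => ¬ beginsWith2 d b) 0 ω' i with hT
  set E := edgesAvoiding d (sortedSeq ω) ∩ edgesAvoiding d (sortedSeq ω') with hE
  have hcard : #E ≤ #T := by
    refine card_le_card_of_injOn (fun e => (e.1 : ℕ)) (fun e he => ?_) (fun e he e' he' h => ?_)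
    · rw [mem_coe, hE, mem_inter] at he
      rw [mem_coe, hT, mem_filter, mem_Ico]
      exact ⟨⟨Nat.zero_le _, by simp⟩, edgeAt_of_mem_edgesAvoiding he.1,
        edgeAt_of_mem_edgesAvoiding he.2⟩
    · simp only [hE, edgesAvoiding, edgeSet, coe_inter, Set.mem_inter_iff, mem_coe, mem_filter,
        mem_univ, true_and] at he he'
      have h1 := he.1.1.1
      have h2 := he'.1.1.1
      dsimp only at h
      exact Prod.ext (Fin.ext h) (Fin.ext (by omega))
  have hsplit : #T = #(T.filter fun i => i % 2 = 0) + #(T.filter fun i => i % 2 = 1) := by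
    rw [← card_filter_add_card_filter_not (s := T) (fun i => i % 2 = 0)]
    congr 2
    exact filter_congr fun i _ => by omega
  have hpar : ∀ r : ℕ, Real.exp (2 * t * #(T.filter fun i => i % 2 = r)) =
      ∑ I ∈ ((Ico 0 (0 + N)).filter (fun i => i % 2 = (r : ℕ))).powerset,
        (Real.exp (2 * t) - 1) ^ #I *
          ((if ∀ i ∈ I, EdgeAt lexVal (fun b : Str k K => ¬ beginsWith2 d b) 0 ω i then 1 else 0) *
          (if ∀ i ∈ I, EdgeAt lexVal (fun b : Str k K => ¬ beginsWith2 d b) 0 ω' i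
            then 1 else 0)) := by
    intro r
    rw [mul_comm, Real.exp_nat_mul, ← add_sub_cancel 1 (Real.exp (2 * t)),
      one_add_pow_card_eq_sum_powerset, add_sub_cancel]
    refine sum_subset_zero_on_sdiff (powerset_mono.2 ?_) ?_ ?_
    · exact filter_subset_filter _ (filter_subset _ _)
    · intro I hI
      rw [mem_sdiff, mem_powerset, mem_powerset] at hI
      rw [ite_zero_mul_ite_zero, if_neg, mul_zero]
      rintro ⟨h1, h2⟩
      refine hI.2 fun i hi => ?_
      have := mem_filter.1 (hI.1 hi)
      exact mem_filter.2 ⟨mem_filter.2 ⟨this.1, h1 i hi, h2 i hi⟩, this.2⟩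
    · intro I hI
      rw [mem_powerset] at hI
      have h : ∀ i ∈ I, _ := fun i hi => (mem_filter.1 (mem_filter.1 (hI hi)).1).2
      rw [if_pos fun i hi => (h i hi).1, if_pos fun i hi => (h i hi).2, mul_one, mul_one]
  rw [Fin.sum_univ_two]
  simp only [Fin.val_zero, Fin.val_one]
  rw [← hpar 0, ← hpar 1]
  refine (Real.exp_le_exp.2 (mul_le_mul_of_nonneg_left (Nat.cast_le.2 hcard) ht.le)).trans ?_
  rw [hsplit]
  set x : ℝ := (#(T.filter fun i => i % 2 = 0) : ℝ)
  set y : ℝ := (#(T.filter fun i => i % 2 = 1) : ℝ)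
  have hx : Real.exp (2 * t * x) = Real.exp (t * x) ^ 2 := by
    rw [← Real.exp_nat_mul]; congr 1; push_cast; ring
  have hy : Real.exp (2 * t * y) = Real.exp (t * y) ^ 2 := by
    rw [← Real.exp_nat_mul]; congr 1; push_cast; ring
  rw [hx, hy, Nat.cast_add, mul_add, Real.exp_add]
  nlinarith [sq_nonneg (Real.exp (t * x) - Real.exp (t * y))]

theorem sum_strP {k : ℕ} {p : Fin k → ℝ} (hsum : ∑ i, p i = 1) (K : ℕ) :
    ∑ s : Str k K, strP p s = 1 := by
  simp only [strP]
  rw [← Fintype.piFinset_univ, ← prod_univ_sum (fun _ => univ) (fun (_ : Fin K) i => p i)]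
  simp [hsum]

theorem expMoment_le {k N K : ℕ} {p : Fin k → ℝ} (hp : ∀ i, 0 < p i) (hsum : ∑ i, p i = 1)
    (d : Fin k) {t Q : ℝ} (ht : 0 < t) (hQ0 : 0 ≤ Q) (hQ : Q ≤ 1 / 2)
    (H : ∀ u m, (u = 0 ∨ ∃ b : Str k K, ¬ beginsWith2 d b ∧ u = lexVal b) → m + 2 ≤ N →
      (Real.exp (2 * t) - 1) * ∑ j ∈ range (m + 1),
        (∑ b : Str k K with ¬ beginsWith2 d b ∧ u ≤ lexVal b, (m + 2 : ℝ) ^ 2 * m.choose j *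
        (strP p b ^ 2 * midMass lexVal (strP p) u b ^ j *
          tailMass lexVal (strP (K := K) p) (lexVal b) ^ (m - j))) ^ 2 ≤
      Q * tailMass lexVal (strP (K := K) p) u ^ (2 * (m + 2))) :
    ∑ ω : Fin N → Str k K, ∑ ω' : Fin N → Str k K, seqP p ω * seqP p ω' *
      Real.exp (t * ((edgesAvoiding d (sortedSeq ω) ∩ edgesAvoiding d (sortedSeq ω')).card : ℝ))
      ≤ 1 + 2 * Q := by
  classical
  have hw : ∀ a : Str k K, 0 < strP p a := fun a => prod_pos fun j _ => hp _
  have hc : 0 ≤ Real.exp (2 * t) - 1 := by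
    rw [sub_nonneg]; exact Real.one_le_exp (by positivity)
  have hmain : ∀ r : Fin 2, ∑ I ∈ ((Ico 0 (0 + N)).filter (fun i => i % 2 = (r : ℕ))).powerset,
      (Real.exp (2 * t) - 1) ^ #I *
      edgeWeight lexVal (strP p) (fun b : Str k K => ¬ beginsWith2 d b) (Fin N) 0 0 I ^ 2 ≤
        1 + 2 * Q := by
    intro r
    refine (edgeWeight_sq_sum_le (fun a => (hw a).le) lexVal_injective (fun b _ => ?_)
      (fun i hi => by omega) hc hQ0 hQ
      (okLevel := fun u => u = 0 ∨ ∃ b : Str k K, ¬ beginsWith2 d b ∧ u = lexVal b)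
      (fun b hb => Or.inr ⟨b, hb, rfl⟩) H N le_rfl (Fin N) (Fintype.card_fin N) 0 0
      (Or.inl rfl)).trans (le_of_eq ?_)
    · refine sum_pos' (fun a _ => tailWeight_nonneg (fun a => (hw a).le) _ _) ⟨b, mem_univ b, ?_⟩
      simpa [tailWeight] using hw b
    · have : tailMass lexVal (strP (K := K) p) 0 = 1 := by
        simp only [tailMass, tailWeight, Nat.zero_le, if_true]
        exact sum_strP hsum K
      rw [this, one_pow, one_mul]
  have hseq : ∀ ω : Fin N → Str k K, seqP p ω = ∏ j, tailWeight lexVal (strP p) 0 (ω j) := by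
    intro ω
    simp [seqP, tailWeight]
  have hseq0 : ∀ ω : Fin N → Str k K, 0 ≤ seqP p ω := fun ω => prod_nonneg fun j _ => (hw _).le
  calc _ ≤ ∑ ω : Fin N → Str k K, ∑ ω' : Fin N → Str k K, seqP p ω * seqP p ω' * _ :=
        sum_le_sum fun ω _ => sum_le_sum fun ω' _ => mul_le_mul_of_nonneg_left
          (exp_card_edges_le d ω ω' ht) (mul_nonneg (hseq0 _) (hseq0 _))
    _ = ∑ r : Fin 2, 1 / 2 * ∑ I ∈ ((Ico 0 (0 + N)).filter (fun i => i % 2 = (r : ℕ))).powerset,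
      (Real.exp (2 * t) - 1) ^ #I *
      edgeWeight lexVal (strP p) (fun b : Str k K => ¬ beginsWith2 d b) (Fin N) 0 0 I ^ 2 := by
        simp only [mul_sum]
        rw [sum_congr rfl fun ω _ => sum_comm, sum_comm]
        refine sum_congr rfl fun r _ => ?_
        rw [sum_congr rfl fun ω _ => sum_comm, sum_comm]
        refine sum_congr rfl fun I _ => ?_
        rw [edgeWeight_eq, sq, sum_mul_sum]
        simp only [mul_sum, ← hseq]
        refine sum_congr rfl fun ω _ => sum_congr rfl fun ω' _ => ?_
        ring
    _ ≤ ∑ r : Fin 2, 1 / 2 * (1 + 2 * Q) :=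
        sum_le_sum fun r _ => mul_le_mul_of_nonneg_left (hmain r) (by norm_num)
    _ = 1 + 2 * Q := by simp

section Binomial

theorem two_mul_add_one_mul_centralBinom_sq_le (n : ℕ) :
    (2 * n + 1) * n.centralBinom ^ 2 ≤ 16 ^ n := by
  induction n with
  | zero => simp
  | succ n ih =>
    have h := Nat.succ_mul_centralBinom_succ n
    have h2 : (n + 1) ^ 2 * ((2 * (n + 1) + 1) * (n + 1).centralBinom ^ 2) ≤
        (n + 1) ^ 2 * 16 ^ (n + 1) := by
      calc (n + 1) ^ 2 * ((2 * (n + 1) + 1) * (n + 1).centralBinom ^ 2)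
          = (2 * (n + 1) + 1) * ((n + 1) * (n + 1).centralBinom) ^ 2 := by ring
        _ = ((2 * n + 3) * (2 * n + 1) * 4) * ((2 * n + 1) * n.centralBinom ^ 2) := by
          rw [h]; ring
        _ ≤ ((n + 1) ^ 2 * 16) * 16 ^ n := Nat.mul_le_mul (by nlinarith) ih
        _ = (n + 1) ^ 2 * 16 ^ (n + 1) := by ring
    exact Nat.le_of_mul_le_mul_left h2 (by positivity)

theorem succ_mul_choose_sq_le (c j : ℕ) : (c + 1) * c.choose j ^ 2 ≤ 4 ^ c := by
  obtain ⟨n, rfl | rfl⟩ := Nat.even_or_odd' c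
  · refine (Nat.mul_le_mul_left _ (Nat.pow_le_pow_left (Nat.choose_le_centralBinom j n) 2)).trans ?_
    rw [pow_mul]
    exact two_mul_add_one_mul_centralBinom_sq_le n
  · have h1 : 2 * (2 * n + 1).choose j ≤ (n + 1).centralBinom := by
      rw [Nat.centralBinom_eq_two_mul_choose, mul_add, mul_one, Nat.choose_succ_succ' (2 * n + 1) n,
        two_mul ((2 * n + 1).choose j), Nat.choose_symm_half]
      have := Nat.choose_le_middle j (2 * n + 1)
      rw [show (2 * n + 1) / 2 = n by omega] at this
      omega
    have h2 := two_mul_add_one_mul_centralBinom_sq_le (n + 1)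
    have h3 := Nat.pow_le_pow_left h1 2
    have h4 : 4 * ((2 * n + 1 + 1) * (2 * n + 1).choose j ^ 2) ≤ 4 * 4 ^ (2 * n + 1) := by
      calc 4 * ((2 * n + 1 + 1) * (2 * n + 1).choose j ^ 2)
          = (2 * n + 2) * (2 * (2 * n + 1).choose j) ^ 2 := by ring
        _ ≤ (2 * (n + 1) + 1) * (n + 1).centralBinom ^ 2 := Nat.mul_le_mul (by omega) h3
        _ ≤ 16 ^ (n + 1) := h2
        _ = 4 * 4 ^ (2 * n + 1) := by rw [← pow_succ', show 16 = 4 ^ 2 by rfl, ← pow_mul]; rfl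
    omega

theorem choose_mul_pow_eq_sum (m j : ℕ) (hj : j ≤ m) (X Y : ℝ) :
    m.choose j * X ^ j * Y ^ (m - j) =
      ∑ c ∈ range (m + 1), (c.choose j / 2 ^ c) *
        (m.choose c * (2 * X) ^ c * (Y - X) ^ (m - c)) := by
  have h1 : ∀ c ∈ range (m + 1), (c.choose j / 2 ^ c : ℝ) *
        (m.choose c * (2 * X) ^ c * (Y - X) ^ (m - c)) =
        m.choose c * c.choose j * X ^ c * (Y - X) ^ (m - c) := by
    intro c _
    rw [mul_pow]
    field_simp
  rw [sum_congr rfl h1, ← sum_range_add_sum_Ico _ (show j ≤ m + 1 by omega), sum_eq_zero, zero_add,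
    sum_Ico_eq_sum_range]
  · conv_lhs => rw [← add_sub_cancel X Y, add_pow, mul_sum]
    rw [show m - j + 1 = m + 1 - j by omega]
    refine sum_congr rfl fun d hd => ?_
    rw [mem_range] at hd
    have := Nat.choose_mul (n := m) (k := j + d) (s := j) (by omega)
    rw [Nat.add_sub_cancel_left] at this
    rw [← Nat.cast_mul, this, show m - (j + d) = m - j - d by omega]
    push_cast
    ring
  · intro c hc
    rw [Nat.choose_eq_zero_of_lt (mem_range.1 hc)]
    simp

theorem choose_mul_pow_sq_le_of_le {m j : ℕ} (hj : j ≤ m) {X Y : ℝ} (hX : 0 < X) (hXY : X ≤ Y) :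
    (m.choose j * X ^ j * Y ^ (m - j)) ^ 2 ≤ (X + Y) ^ (2 * m + 1) / (2 * (m + 1) * X) := by
  set P : ℕ → ℝ := fun c => m.choose c * (2 * X) ^ c * (Y - X) ^ (m - c) with hP
  have hP0 : ∀ c, 0 ≤ P c := fun c => mul_nonneg (mul_nonneg (Nat.cast_nonneg _)
    (pow_nonneg (by linarith) _)) (pow_nonneg (by linarith) _)
  have hsum : ∑ c ∈ range (m + 1), P c = (X + Y) ^ m := by
    rw [show X + Y = 2 * X + (Y - X) by ring, add_pow]
    exact sum_congr rfl fun c _ => by simp only [hP]; ring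
  have hsum2 : ∑ c ∈ range (m + 1), P c / (c + 1) ≤ (X + Y) ^ (m + 1) / (2 * (m + 1) * X) := by
    rw [le_div_iff₀ (by positivity), sum_mul, show X + Y = 2 * X + (Y - X) by ring, add_pow,
      sum_range_succ' _ (m + 1)]
    refine le_add_of_le_of_nonneg (le_of_eq (sum_congr rfl fun c hc => ?_)) ?_
    · have h := Nat.add_one_mul_choose_eq m c
      have h' : ((m : ℝ) + 1) * m.choose c = (m + 1).choose (c + 1) * (c + 1) := by exact_mod_cast h
      have hc0 : (c : ℝ) + 1 ≠ 0 := by positivity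
      rw [Nat.add_sub_add_right]
      simp only [hP]
      rw [div_mul_eq_mul_div, div_eq_iff hc0]
      linear_combination (2 * X) ^ (c + 1) * (Y - X) ^ (m - c) * h'
    · exact mul_nonneg (mul_nonneg (pow_nonneg (by linarith) _) (pow_nonneg (by linarith) _))
        (Nat.cast_nonneg _)
  have hCS := sum_sq_le_sum_mul_sum_of_sq_le_mul (range (m + 1))
    (r := fun c => (c.choose j / 2 ^ c : ℝ) * P c) (f := P) (g := fun c => P c / (c + 1))
    (fun c _ => hP0 c) (fun c _ => div_nonneg (hP0 c) (by positivity)) (fun c _ => by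
      have h : ((c : ℝ) + 1) * c.choose j ^ 2 ≤ 4 ^ c := by exact_mod_cast succ_mul_choose_sq_le c j
      have h2 : (c.choose j / 2 ^ c : ℝ) ^ 2 ≤ 1 / (c + 1) := by
        rw [div_pow, div_le_div_iff₀ (by positivity) (by positivity), ← pow_mul, mul_comm c 2,
          pow_mul]
        norm_num
        linarith
      calc ((c.choose j / 2 ^ c : ℝ) * P c) ^ 2 = (c.choose j / 2 ^ c : ℝ) ^ 2 * P c ^ 2 := by ring
        _ ≤ 1 / (c + 1) * P c ^ 2 := mul_le_mul_of_nonneg_right h2 (sq_nonneg _)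
        _ = P c * (P c / (c + 1)) := by ring)
  rw [choose_mul_pow_eq_sum m j hj]
  refine hCS.trans ?_
  rw [hsum]
  calc (X + Y) ^ m * ∑ c ∈ range (m + 1), P c / (c + 1)
      ≤ (X + Y) ^ m * ((X + Y) ^ (m + 1) / (2 * (m + 1) * X)) :=
        mul_le_mul_of_nonneg_left hsum2 (pow_nonneg (by linarith) _)
    _ = (X + Y) ^ (2 * m + 1) / (2 * (m + 1) * X) := by ring

/-- A binomial point mass with both success and failure probability inflated by `1 / (m + 1)`. -/
noncomputable def binomKernel (m : ℕ) (x : ℝ) (j : ℕ) : ℝ :=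
  m.choose j * (x + 1 / (m + 1)) ^ j * (1 - x + 1 / (m + 1)) ^ (m - j)

theorem binomKernel_nonneg {m : ℕ} {x : ℝ} (hx0 : 0 ≤ x) (hx1 : x ≤ 1) (j : ℕ) :
    0 ≤ binomKernel m x j := by
  have : 0 ≤ 1 - x := by linarith
  unfold binomKernel
  positivity

theorem binomKernel_le {m j : ℕ} (hj : j ≤ m) {x κ : ℝ} (hκ0 : 0 < κ) (hx0 : 0 ≤ x)
    (hx1 : x ≤ 1 - κ) :
    binomKernel m x j ≤ Real.exp 2 / √κ / √((m + 1) * x + 1) := by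
  have hM : (0 : ℝ) < m + 1 := by positivity
  set X := x + 1 / ((m : ℝ) + 1) with hX
  set Y := 1 - x + 1 / ((m : ℝ) + 1) with hY
  have h1M : 0 < 1 / ((m : ℝ) + 1) := by positivity
  have h1M' : 1 / ((m : ℝ) + 1) ≤ 1 := by rw [div_le_one hM]; linarith [m.cast_nonneg (α := ℝ)]
  have hX0 : 0 < X := by linarith
  have hY0 : κ ≤ Y := by linarith
  have hMX : ((m : ℝ) + 1) * X = (m + 1) * x + 1 := by rw [hX]; field_simp
  have hXY : X + Y = 1 + 2 / ((m : ℝ) + 1) := by rw [hX, hY]; ring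
  have hs : (X + Y) ^ (2 * m + 1) ≤ Real.exp 4 := by
    have h0 : 0 ≤ 2 / ((m : ℝ) + 1) := by positivity
    have h1 : X + Y ≤ Real.exp (2 / ((m : ℝ) + 1)) := by
      rw [hXY, add_comm]; exact Real.add_one_le_exp _
    refine (pow_le_pow_left₀ (by linarith) h1 _).trans ?_
    rw [← Real.exp_nat_mul, Real.exp_le_exp, mul_div_assoc', div_le_iff₀ hM]
    push_cast
    linarith
  have hsq : (m.choose j * X ^ j * Y ^ (m - j)) ^ 2 ≤ Real.exp 4 / (κ * ((m + 1) * X)) := by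
    rcases le_total X Y with h | h
    · refine (choose_mul_pow_sq_le_of_le hj hX0 h).trans ?_
      refine div_le_div₀ (Real.exp_pos _).le hs (by positivity) ?_
      rw [mul_assoc]
      exact mul_le_mul_of_nonneg_right (by linarith) (by positivity)
    · have h2 := choose_mul_pow_sq_le_of_le (m := m) (j := m - j) (by omega)
        (hκ0.trans_le hY0) h
      rw [Nat.choose_symm hj, Nat.sub_sub_self hj, add_comm Y X] at h2
      rw [show (m.choose j * X ^ j * Y ^ (m - j) : ℝ) = m.choose j * Y ^ (m - j) * X ^ j by ring]
      refine h2.trans (div_le_div₀ (Real.exp_pos _).le hs (by positivity) ?_)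
      have h3 : κ * X ≤ 2 * Y := by nlinarith
      nlinarith
  unfold binomKernel
  rw [← hX, ← hY, ← hMX, div_div, ← Real.sqrt_mul hκ0.le]
  refine le_of_sq_le_sq ?_ (by positivity)
  rw [div_pow, Real.sq_sqrt (by positivity), ← Real.exp_nat_mul]
  norm_num
  exact hsq

set_option maxHeartbeats 1000000 in
theorem sum_binomKernel_mul_le {m : ℕ} {x x' κ : ℝ} (hκ0 : 0 < κ) (hx0 : 0 ≤ x)
    (hx1 : x ≤ 1 - κ) (hx0' : 0 ≤ x') (hx1' : x' ≤ 1 - κ) :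
    ∑ j ∈ range (m + 1), binomKernel m x j * binomKernel m x' j ≤
      Real.exp 7 / √κ / (√⌊√((m + 1) * x + 1)⌋₊ * √⌊√((m + 1) * x' + 1)⌋₊) *
        (1 / 2) ^ ((⌊√((m + 1) * x + 1)⌋₊ - ⌊√((m + 1) * x' + 1)⌋₊) +
          (⌊√((m + 1) * x' + 1)⌋₊ - ⌊√((m + 1) * x + 1)⌋₊)) := by
  have hM : (0 : ℝ) < m + 1 := by positivity
  have h1M : 0 < 1 / ((m : ℝ) + 1) := by positivity
  have h1M' : 1 / ((m : ℝ) + 1) ≤ 1 := by rw [div_le_one hM]; linarith [m.cast_nonneg (α := ℝ)]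
  set r := √((m + 1) * x + 1) with hr
  set r' := √((m + 1) * x' + 1) with hr'
  have hr1 : 1 ≤ r := by rw [hr, Real.one_le_sqrt]; nlinarith
  have hr1' : 1 ≤ r' := by rw [hr', Real.one_le_sqrt]; nlinarith
  set l := ⌊r⌋₊
  set l' := ⌊r'⌋₊
  have hl : 1 ≤ l := Nat.one_le_floor_iff _ |>.2 hr1
  have hl' : 1 ≤ l' := Nat.one_le_floor_iff _ |>.2 hr1'
  have hlr : (l : ℝ) ≤ r := Nat.floor_le (by linarith)
  have hlr' : (l' : ℝ) ≤ r' := Nat.floor_le (by linarith)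
  have hlr2 : r < l + 1 := Nat.lt_floor_add_one _
  have hlr2' : r' < l' + 1 := Nat.lt_floor_add_one _
  have hl0 : (0 : ℝ) < l := by exact_mod_cast hl
  have hl0' : (0 : ℝ) < l' := by exact_mod_cast hl'
  set d := (l - l') + (l' - l) with hd
  have hdr : (d : ℝ) ≤ |r - r'| + 1 := by
    rcases le_total l l' with h | h
    · have : d = l' - l := by omega
      rw [this, Nat.cast_sub h]
      linarith [neg_abs_le (r - r')]
    · have : d = l - l' := by omega
      rw [this, Nat.cast_sub h]
      linarith [le_abs_self (r - r')]
  set a := √(x + 1 / ((m : ℝ) + 1)) with ha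
  set a' := √(x' + 1 / ((m : ℝ) + 1)) with ha'
  set b := √(1 - x + 1 / ((m : ℝ) + 1)) with hb
  set b' := √(1 - x' + 1 / ((m : ℝ) + 1)) with hb'
  have ha2 : a ^ 2 = x + 1 / ((m : ℝ) + 1) := Real.sq_sqrt (by positivity)
  have ha2' : a' ^ 2 = x' + 1 / ((m : ℝ) + 1) := Real.sq_sqrt (by positivity)
  have hb2 : b ^ 2 = 1 - x + 1 / ((m : ℝ) + 1) := Real.sq_sqrt (by linarith)
  have hb2' : b' ^ 2 = 1 - x' + 1 / ((m : ℝ) + 1) := Real.sq_sqrt (by linarith)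
  have ha0 : 0 ≤ a := Real.sqrt_nonneg _
  have ha0' : 0 ≤ a' := Real.sqrt_nonneg _
  have hb0 : 0 ≤ b := Real.sqrt_nonneg _
  have hb0' : 0 ≤ b' := Real.sqrt_nonneg _
  have hra : r = √((m : ℝ) + 1) * a := by
    rw [hr, ha, ← Real.sqrt_mul hM.le]; congr 1; field_simp
  have hra' : r' = √((m : ℝ) + 1) * a' := by
    rw [hr', ha', ← Real.sqrt_mul hM.le]; congr 1; field_simp
  have hMD : ((m : ℝ) + 1) * (a - a') ^ 2 = (r - r') ^ 2 := by
    rw [hra, hra', ← mul_sub, mul_pow, Real.sq_sqrt hM.le]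
  set γ : ℕ → ℝ := fun j => m.choose j * (a * a') ^ j * (b * b') ^ (m - j) with hγ
  have hγ0 : ∀ j, 0 ≤ γ j := fun j => by positivity
  have hγ2 : ∀ j, γ j ^ 2 = binomKernel m x j * binomKernel m x' j := by
    intro j
    simp only [hγ, binomKernel]
    rw [← ha2, ← ha2', ← hb2, ← hb2']
    ring
  have hγsup : ∀ j ∈ range (m + 1), γ j ≤ Real.exp 2 / √κ / (√l * √l') := by
    intro j hj
    have hj' : j ≤ m := by rw [mem_range] at hj; omega
    have hκ' : 0 < √κ := Real.sqrt_pos.2 hκ0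
    refine le_of_sq_le_sq ?_ (by positivity)
    rw [hγ2, div_pow, mul_pow, Real.sq_sqrt hl0.le, Real.sq_sqrt hl0'.le]
    have h1 : binomKernel m x j ≤ Real.exp 2 / √κ / l :=
      (binomKernel_le hj' hκ0 hx0 hx1).trans (div_le_div_of_nonneg_left (by positivity) hl0 hlr)
    have h2 : binomKernel m x' j ≤ Real.exp 2 / √κ / l' :=
      (binomKernel_le hj' hκ0 hx0' hx1').trans
        (div_le_div_of_nonneg_left (by positivity) hl0' hlr')
    refine (mul_le_mul h1 h2 (binomKernel_nonneg hx0' (by linarith) j)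
      (by positivity)).trans (le_of_eq ?_)
    rw [div_mul_div_comm, sq]
  have hγsum : ∑ j ∈ range (m + 1), γ j ≤ Real.exp 5 * (1 / 2) ^ d := by
    have h1 : ∑ j ∈ range (m + 1), γ j = (a * a' + b * b') ^ m := by
      rw [add_pow]
      exact sum_congr rfl fun j _ => by simp only [hγ]; ring
    have h2 : a * a' + b * b' ≤ Real.exp (2 / ((m : ℝ) + 1) - (a - a') ^ 2 / 2) := by
      refine le_trans ?_ (Real.add_one_le_exp _)
      have : 2 / ((m : ℝ) + 1) = 2 * (1 / ((m : ℝ) + 1)) := by ring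
      linarith [sq_nonneg (b - b'), sub_sq b b', sub_sq a a']
    have h3 : (a - a') ^ 2 ≤ 2 := by
      have : (a - a') ^ 2 ≤ max (a ^ 2) (a' ^ 2) := by
        rcases le_total a a' with h | h
        · exact le_max_of_le_right (by nlinarith)
        · exact le_max_of_le_left (by nlinarith)
      refine this.trans (max_le ?_ ?_) <;> linarith
    have h4 : (m : ℝ) * (2 / ((m : ℝ) + 1) - (a - a') ^ 2 / 2) ≤ 5 - d := by
      have h5 : (m : ℝ) * (2 / ((m : ℝ) + 1)) ≤ 2 := by
        rw [mul_div_assoc', div_le_iff₀ hM]; linarith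
      have h6 : (d : ℝ) ≤ (r - r') ^ 2 / 2 + 3 / 2 := by
        linarith [sq_nonneg (|r - r'| - 1), sq_abs (r - r'), sub_sq |r - r'| 1]
      linarith
    have h7 : Real.exp (5 - d) ≤ Real.exp 5 * (1 / 2) ^ d := by
      rw [sub_eq_add_neg, Real.exp_add]
      refine mul_le_mul_of_nonneg_left ?_ (Real.exp_pos _).le
      rw [show -(d : ℝ) = d * (-1) by ring, Real.exp_nat_mul]
      refine pow_le_pow_left₀ (Real.exp_pos _).le ?_ _
      rw [Real.exp_neg, inv_eq_one_div]
      exact one_div_le_one_div_of_le (by norm_num) (by linarith [Real.add_one_le_exp (1 : ℝ)])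
    rw [h1]
    refine (pow_le_pow_left₀ (by positivity) h2 m).trans ?_
    rw [← Real.exp_nat_mul]
    exact (Real.exp_le_exp.2 h4).trans h7
  calc ∑ j ∈ range (m + 1), binomKernel m x j * binomKernel m x' j
      = ∑ j ∈ range (m + 1), γ j * γ j := sum_congr rfl fun j _ => by rw [← hγ2, sq]
    _ ≤ ∑ j ∈ range (m + 1), Real.exp 2 / √κ / (√l * √l') * γ j :=
        sum_le_sum fun j hj => mul_le_mul_of_nonneg_right (hγsup j hj) (hγ0 j)
    _ = Real.exp 2 / √κ / (√l * √l') * ∑ j ∈ range (m + 1), γ j := by rw [mul_sum]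
    _ ≤ Real.exp 2 / √κ / (√l * √l') * (Real.exp 5 * (1 / 2) ^ d) :=
        mul_le_mul_of_nonneg_left hγsum (by positivity)
    _ = Real.exp 7 / √κ / (√l * √l') * (1 / 2) ^ d := by
        rw [show (7 : ℝ) = 2 + 5 by norm_num, Real.exp_add]; ring

theorem sum_half_pow_le {β : Type} (s : Finset β) (f : β → ℕ) (hf : Set.InjOn f s) :
    ∑ x ∈ s, (1 / 2 : ℝ) ^ f x ≤ 2 := by
  classical
  rw [← sum_image (f := fun i => (1 / 2 : ℝ) ^ i) hf]
  exact (summable_geometric_two.sum_le_tsum _ fun _ _ => by positivity).trans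
    tsum_geometric_two.le

theorem sum_half_pow_dist_le (s : Finset ℕ) (l : ℕ) :
    ∑ l' ∈ s, (1 / 2 : ℝ) ^ ((l - l') + (l' - l)) ≤ 4 := by
  rw [← sum_filter_add_sum_filter_not s (· ≤ l)]
  have h1 := sum_half_pow_le (s.filter (· ≤ l)) (fun l' => (l - l') + (l' - l))
    (fun x hx y hy h => by
      simp only [coe_filter, Set.mem_ofPred_eq] at hx hy h
      omega)
  have h2 := sum_half_pow_le (s.filter (¬ · ≤ l)) (fun l' => (l - l') + (l' - l))
    (fun x hx y hy h => by
      simp only [coe_filter, Set.mem_ofPred_eq] at hx hy h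
      omega)
  linarith

theorem sum_mul_half_pow_dist_le (s : Finset ℕ) (y : ℕ → ℝ) :
    ∑ l ∈ s, ∑ l' ∈ s, y l * y l' * (1 / 2 : ℝ) ^ ((l - l') + (l' - l)) ≤
      4 * ∑ l ∈ s, y l ^ 2 := by
  have h : ∀ l ∈ s, ∀ l' ∈ s, y l * y l' * (1 / 2 : ℝ) ^ ((l - l') + (l' - l)) ≤
      1 / 2 * (y l ^ 2 * (1 / 2 : ℝ) ^ ((l - l') + (l' - l))) +
      1 / 2 * (y l' ^ 2 * (1 / 2 : ℝ) ^ ((l' - l) + (l - l'))) := by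
    intro l _ l' _
    rw [add_comm (l' - l)]
    nlinarith [mul_nonneg (sq_nonneg (y l - y l'))
      (show (0 : ℝ) ≤ (1 / 2) ^ ((l - l') + (l' - l)) by positivity)]
  have h2 : ∀ l ∈ s, ∑ l' ∈ s, y l ^ 2 * (1 / 2 : ℝ) ^ ((l - l') + (l' - l)) ≤ 4 * y l ^ 2 := by
    intro l _
    rw [← mul_sum, mul_comm]
    exact mul_le_mul_of_nonneg_right (sum_half_pow_dist_le s l) (sq_nonneg _)
  refine (sum_le_sum fun l hl => sum_le_sum fun l' hl' => h l hl l' hl').trans ?_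
  simp only [sum_add_distrib, ← mul_sum]
  rw [sum_comm (f := fun l l' => y l' ^ 2 * (1 / 2 : ℝ) ^ ((l' - l) + (l - l'))), mul_sum]
  have := sum_le_sum h2
  simp only [← mul_sum] at this ⊢
  linarith

theorem sum_sq_sum_binomKernel_le {α : Type} (B : Finset α) {a x : α → ℝ} {κ : ℝ} (hκ0 : 0 < κ)
    (ha : ∀ b ∈ B, 0 ≤ a b) (hx0 : ∀ b ∈ B, 0 ≤ x b) (hx1 : ∀ b ∈ B, x b ≤ 1 - κ) (m : ℕ) :
    ∑ j ∈ range (m + 1), (∑ b ∈ B, a b * binomKernel m (x b) j) ^ 2 ≤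
      4 * Real.exp 7 / √κ * ∑ l ∈ Icc 1 (Nat.sqrt (m + 2)),
        (∑ b ∈ B with ⌊√((m + 1) * x b + 1)⌋₊ = l, a b) ^ 2 / l := by
  have hM : (0 : ℝ) < m + 1 := by positivity
  set ℓ : α → ℕ := fun b => ⌊√((m + 1) * x b + 1)⌋₊ with hℓ
  have hmaps : ∀ b ∈ B, ℓ b ∈ Icc 1 (Nat.sqrt (m + 2)) := by
    intro b hb
    have h0 := hx0 b hb
    have h1 := hx1 b hb
    rw [mem_Icc]
    constructor
    · rw [hℓ, Nat.one_le_floor_iff, Real.one_le_sqrt]; nlinarith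
    · rw [← Real.nat_floor_real_sqrt_eq_nat_sqrt]
      refine Nat.floor_le_floor (Real.sqrt_le_sqrt ?_)
      push_cast
      nlinarith
  set ν : ℕ → ℝ := fun l => ∑ b ∈ B with ℓ b = l, a b with hν
  have hfib : ∀ g : ℕ → ℝ, ∑ b ∈ B, a b * g (ℓ b) = ∑ l ∈ Icc 1 (Nat.sqrt (m + 2)), ν l * g l := by
    intro g
    rw [← sum_fiberwise_of_maps_to hmaps]
    refine sum_congr rfl fun l _ => ?_
    rw [hν, sum_mul]
    exact sum_congr rfl fun b hb => by rw [(mem_filter.1 hb).2]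
  set D := Real.exp 7 / √κ with hD
  have hD0 : 0 ≤ D := by positivity
  calc ∑ j ∈ range (m + 1), (∑ b ∈ B, a b * binomKernel m (x b) j) ^ 2
      = ∑ b ∈ B, ∑ b' ∈ B, a b * a b' *
          ∑ j ∈ range (m + 1), binomKernel m (x b) j * binomKernel m (x b') j := by
        simp only [sq, sum_mul_sum]
        rw [sum_comm]
        refine sum_congr rfl fun b _ => ?_
        rw [sum_comm]
        refine sum_congr rfl fun b' _ => ?_
        rw [mul_sum]
        exact sum_congr rfl fun j _ => by ring
    _ ≤ ∑ b ∈ B, ∑ b' ∈ B, a b * a b' * (D / (√(ℓ b) * √(ℓ b')) *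
          (1 / 2) ^ ((ℓ b - ℓ b') + (ℓ b' - ℓ b))) :=
        sum_le_sum fun b hb => sum_le_sum fun b' hb' => mul_le_mul_of_nonneg_left
          (sum_binomKernel_mul_le hκ0 (hx0 b hb) (hx1 b hb) (hx0 b' hb') (hx1 b' hb'))
          (mul_nonneg (ha b hb) (ha b' hb'))
    _ = D * ∑ l ∈ Icc 1 (Nat.sqrt (m + 2)), ∑ l' ∈ Icc 1 (Nat.sqrt (m + 2)), (ν l / √l) * (ν l' / √l') *
          (1 / 2) ^ ((l - l') + (l' - l)) := by
        have h1 : ∀ b ∈ B, ∑ b' ∈ B, a b * a b' * (D / (√(ℓ b) * √(ℓ b')) *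
            (1 / 2) ^ ((ℓ b - ℓ b') + (ℓ b' - ℓ b))) =
            a b * (D * ∑ l' ∈ Icc 1 (Nat.sqrt (m + 2)), ν l' * (1 / (√(ℓ b) * √l') *
              (1 / 2) ^ ((ℓ b - l') + (l' - ℓ b)))) := by
          intro b _
          rw [← hfib (fun l' => 1 / (√(ℓ b) * √l') * (1 / 2) ^ ((ℓ b - l') + (l' - ℓ b))),
            mul_sum, mul_sum]
          exact sum_congr rfl fun b' _ => by ring
        rw [sum_congr rfl h1, hfib (fun l => D * ∑ l' ∈ Icc 1 (Nat.sqrt (m + 2)), ν l' *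
          (1 / (√l * √l') * (1 / 2) ^ ((l - l') + (l' - l)))), mul_sum]
        refine sum_congr rfl fun l _ => ?_
        simp only [mul_sum]
        exact sum_congr rfl fun l' _ => by ring
    _ ≤ D * (4 * ∑ l ∈ Icc 1 (Nat.sqrt (m + 2)), (ν l / √l) ^ 2) :=
        mul_le_mul_of_nonneg_left (sum_mul_half_pow_dist_le _ _) hD0
    _ = 4 * Real.exp 7 / √κ * ∑ l ∈ Icc 1 (Nat.sqrt (m + 2)), ν l ^ 2 / l := by
        have h2 : ∀ l ∈ Icc 1 (Nat.sqrt (m + 2)), (ν l / √l) ^ 2 = ν l ^ 2 / l := by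
          intro l _
          rw [div_pow, Real.sq_sqrt (Nat.cast_nonneg l)]
        rw [sum_congr rfl h2, hD]
        ring

end Binomial

section StringMass

variable {k : ℕ} {p : Fin k → ℝ}

/-- Cumulative probability of the strings strictly below `s` in lexicographic order. -/
noncomputable def cumul (p : Fin k → ℝ) {K : ℕ} (s : Str k K) : ℝ :=
  ∑ c : Str k K, if lexVal c < lexVal s then strP p c else 0

/-- Total `g`-weight of the strings whose cumulative probability lies in `[a, b]`. -/
noncomputable def stringMass (p g : Fin k → ℝ) (K : ℕ) (a b : ℝ) : ℝ :=
  ∑ s : Str k K, if a ≤ cumul p s ∧ cumul p s ≤ b then ∏ j, g (s j) else 0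

theorem sum_str_succ (K : ℕ) (f : Str k (K + 1) → ℝ) :
    ∑ s, f s = ∑ i, ∑ s : Str k K, f (Fin.cons i s) := by
  rw [← (Fin.consEquiv fun _ : Fin (K + 1) => Fin k).sum_comp, Fintype.sum_prod_type]
  rfl

theorem cumul_cons (hsum : ∑ i, p i = 1) {K : ℕ} (i : Fin k) (s : Str k K) :
    cumul p (Fin.cons i s : Str k (K + 1)) = (∑ j, if j < i then p j else 0) + p i * cumul p s := by
  have h : ∀ j, ∑ c : Str k K, (if lexVal (Fin.cons j c : Str k (K + 1)) <
      lexVal (Fin.cons i s : Str k (K + 1)) then strP p (Fin.cons j c : Str k (K + 1)) else 0) =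
      (if j < i then p j else 0) + if j = i then p i * cumul p s else 0 := by
    intro j
    have hP : ∀ c : Str k K, strP p (Fin.cons j c : Str k (K + 1)) = p j * strP p c := fun c => by
      simp [strP, Fin.prod_univ_succ]
    rcases lt_trichotomy j i with h | rfl | h
    · simp only [lexVal_cons_lt_cons h, if_true, h, h.ne, if_false, add_zero, hP, ← mul_sum,
        sum_strP hsum, mul_one]
    · simp only [lexVal_cons, add_lt_add_iff_left, lt_irrefl, if_false, if_true, zero_add, hP,
        cumul, mul_sum, mul_ite, mul_zero]
    · rw [if_neg h.not_gt, if_neg h.ne', add_zero]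
      exact sum_eq_zero fun c _ => if_neg (lexVal_cons_lt_cons h _ _).not_gt
  rw [cumul, sum_str_succ, sum_congr rfl fun j _ => h j, sum_add_distrib, sum_ite_eq' univ i,
    if_pos (mem_univ i)]

theorem cumul_nonneg (hp : ∀ i, 0 < p i) {K : ℕ} (s : Str k K) : 0 ≤ cumul p s :=
  sum_nonneg fun c _ => by split_ifs; exacts [prod_nonneg fun j _ => (hp _).le, le_rfl]

theorem cumul_le_one (hp : ∀ i, 0 < p i) (hsum : ∑ i, p i = 1) {K : ℕ} (s : Str k K) :
    cumul p s ≤ 1 := by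
  rw [← sum_strP hsum K]
  exact sum_le_sum fun c _ => by split_ifs; exacts [le_rfl, prod_nonneg fun j _ => (hp _).le]

theorem stringMass_succ (hp : ∀ i, 0 < p i) (hsum : ∑ i, p i = 1) (g : Fin k → ℝ) (K : ℕ)
    (a b : ℝ) : stringMass p g (K + 1) a b = ∑ i, g i * stringMass p g K
      ((a - ∑ j, if j < i then p j else 0) / p i) ((b - ∑ j, if j < i then p j else 0) / p i) := by
  rw [stringMass, sum_str_succ]
  refine sum_congr rfl fun i _ => ?_
  rw [stringMass, mul_sum]
  refine sum_congr rfl fun s _ => ?_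
  rw [mul_ite, mul_zero, Fin.prod_univ_succ, cumul_cons hsum]
  simp only [Fin.cons_zero, Fin.cons_succ]
  refine if_congr ?_ rfl rfl
  rw [div_le_iff₀ (hp i), le_div_iff₀ (hp i), sub_le_iff_le_add, le_sub_iff_add_le,
    mul_comm (cumul p s), add_comm (p i * cumul p s)]

theorem stringMass_nonneg {g : Fin k → ℝ} (hg : ∀ i, 0 ≤ g i) (K : ℕ) (a b : ℝ) :
    0 ≤ stringMass p g K a b :=
  sum_nonneg fun s _ => by split_ifs; exacts [prod_nonneg fun j _ => hg _, le_rfl]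

theorem sum_prod_str (g : Fin k → ℝ) (K : ℕ) :
    ∑ s : Str k K, ∏ j, g (s j) = (∑ i, g i) ^ K := by
  rw [← Fintype.piFinset_univ, ← prod_univ_sum (fun _ => univ) (fun (_ : Fin K) i => g i)]
  simp

theorem stringMass_le {g : Fin k → ℝ} (hg : ∀ i, 0 ≤ g i) (K : ℕ) (a b : ℝ) :
    stringMass p g K a b ≤ (∑ i, g i) ^ K := by
  rw [← sum_prod_str]
  exact sum_le_sum fun s _ => by split_ifs; exacts [le_rfl, prod_nonneg fun j _ => hg _]

theorem stringMass_eq_zero_or (hp : ∀ i, 0 < p i) (hsum : ∑ i, p i = 1) {h : ℝ} (hh : 1 ≤ h)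
    (g : Fin k → ℝ) (K : ℕ) (a b : ℝ) : stringMass p g K a b = 0 ∨
      ∀ g' : Fin k → ℝ, stringMass p g' K (a - h) (b + h) = (∑ i, g' i) ^ K := by
  by_cases hex : ∃ s : Str k K, a ≤ cumul p s ∧ cumul p s ≤ b
  · right
    intro g'
    obtain ⟨s, hs1, hs2⟩ := hex
    have h0 := cumul_nonneg hp s
    have h1 := cumul_le_one hp hsum s
    rw [stringMass, ← sum_prod_str]
    refine sum_congr rfl fun c _ => if_pos ?_
    have h0' := cumul_nonneg hp c
    have h1' := cumul_le_one hp hsum c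
    constructor <;> linarith
  · left
    push Not at hex
    refine sum_eq_zero fun s _ => if_neg fun hs => ?_
    exact absurd hs.2 (not_le.2 (hex s hs.1))

theorem one_le_max_mul_rpow {h B e : ℝ} (h1 : 1 ≤ h) (hB : h ≤ B) :
    1 ≤ max 1 (B ^ (-e)) * h ^ e := by
  have hh : 0 < h := by linarith
  rcases le_total 0 e with he | he
  · exact one_le_mul_of_one_le_of_one_le (le_max_left _ _) (Real.one_le_rpow h1 he)
  · calc 1 = B ^ (-e) * B ^ e := by
          rw [← Real.rpow_add (by linarith), neg_add_cancel, Real.rpow_zero]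
      _ ≤ max 1 (B ^ (-e)) * h ^ e := by
          refine mul_le_mul (le_max_right _ _) ?_ (Real.rpow_nonneg (by linarith) _)
            (le_trans zero_le_one (le_max_left _ _))
          exact Real.rpow_le_rpow_of_nonpos hh hB he

theorem div_window (q a h P : ℝ) :
    (a - h - P) / q = (a - P) / q - h / q := by ring

theorem div_window' (q a h P : ℝ) :
    (a + h - P) / q = (a - P) / q + h / q := by ring

theorem stringMass_sq_le (hp : ∀ i, 0 < p i) (hsum : ∑ i, p i = 1) {Pm q : ℝ}
    (hPm : ∀ i, p i ≤ Pm) (hq0 : 0 < q) (hq : ∀ i, q ≤ p i) {θ : ℝ}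
    (hθ : ∑ i, p i ^ θ = (∑ i, p i ^ 2) ^ 2) (hne : 0 < ∑ i, p i ^ 2) (K : ℕ) (a b h : ℝ)
    (hh : Pm ^ K ≤ h) (hh2 : h ≤ 2 / q) :
    stringMass p (fun i => p i ^ 2) K a b ^ 2 ≤
      max 1 ((2 / q) ^ (-(3 - θ))) * (∑ i, p i ^ 2) ^ (2 * K) * h ^ (3 - θ) *
        stringMass p p K (a - h) (b + h) *
        stringMass p (fun i => p i ^ θ / (∑ i, p i ^ 2) ^ 2) K (a - h) (b + h) := by
  have hnu : ∀ i, 0 ≤ p i ^ 2 := fun i => sq_nonneg _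
  have hm : ∀ i, 0 ≤ p i ^ θ / (∑ i, p i ^ 2) ^ 2 := fun i => by
    have := hp i
    positivity
  have hA : 0 < max 1 ((2 / q) ^ (-(3 - θ))) := lt_of_lt_of_le one_pos (le_max_left _ _)
  induction K generalizing a b h with
  | zero =>
    rw [pow_zero] at hh
    rcases stringMass_eq_zero_or hp hsum hh (fun i => p i ^ 2) 0 a b with h0 | h0
    · rw [h0, zero_pow two_ne_zero]
      have := stringMass_nonneg (p := p) (fun i => (hp i).le) 0 (a - h) (b + h)
      have := stringMass_nonneg (p := p) hm 0 (a - h) (b + h)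
      have := Real.rpow_nonneg (by linarith : 0 ≤ h) (3 - θ)
      positivity
    · rw [h0, h0]
      have h1 := stringMass_le (p := p) hnu 0 a b
      have h2 := stringMass_nonneg (p := p) hnu 0 a b
      have h3 := one_le_max_mul_rpow (e := 3 - θ) hh hh2
      simp only [pow_zero, mul_zero, mul_one] at h1 ⊢
      exact (pow_le_one₀ h2 h1).trans h3
  | succ K ih =>
    rcases le_or_gt 1 h with h1 | h1
    · rcases stringMass_eq_zero_or hp hsum h1 (fun i => p i ^ 2) (K + 1) a b with h0 | h0
      · rw [h0, zero_pow two_ne_zero]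
        have := stringMass_nonneg (p := p) (fun i => (hp i).le) (K + 1) (a - h) (b + h)
        have := stringMass_nonneg (p := p) hm (K + 1) (a - h) (b + h)
        have := Real.rpow_nonneg (by linarith : 0 ≤ h) (3 - θ)
        positivity
      · rw [h0, h0, ← sum_div, hθ, div_self (by positivity), hsum, one_pow, mul_one, mul_one]
        have h2 := stringMass_le (p := p) hnu (K + 1) a b
        have h3 := one_le_max_mul_rpow (e := 3 - θ) h1 hh2
        have h4 := pow_le_pow_left₀ (stringMass_nonneg (p := p) hnu (K + 1) a b) h2 2
        rw [← pow_mul, mul_comm (K + 1) 2] at h4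
        refine h4.trans ?_
        nlinarith [pow_pos hne (2 * (K + 1))]
    · have hi : ∀ i, Pm ^ K ≤ h / p i ∧ h / p i ≤ 2 / q := by
        intro i
        have hPm0 : 0 < Pm := (hp i).trans_le (hPm i)
        constructor
        · rw [le_div_iff₀ (hp i)]
          refine le_trans ?_ hh
          rw [pow_succ]
          exact mul_le_mul_of_nonneg_left (hPm i) (by positivity)
        · exact div_le_div₀ (by norm_num) (by linarith) hq0 (hq i)
      have hh0 : 0 ≤ h := by
        refine le_trans ?_ hh
        rcases isEmpty_or_nonempty (Fin k) with he | ⟨⟨i⟩⟩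
        · simp at hne
        · exact pow_nonneg ((hp i).le.trans (hPm i)) _
      simp only [stringMass_succ hp hsum, div_window, div_window']
      set A := max 1 ((2 / q) ^ (-(3 - θ))) with hAdef
      set φ := ∑ i, p i ^ 2 with hφ
      set L : Fin k → ℝ := fun i => (a - ∑ j, if j < i then p j else 0) / p i with hL
      set U : Fin k → ℝ := fun i => (b - ∑ j, if j < i then p j else 0) / p i with hU
      have hcs := sum_sq_le_sum_mul_sum_of_sq_le_mul univ
        (r := fun i => p i ^ 2 * stringMass p (fun i => p i ^ 2) K (L i) (U i))
        (f := fun i => p i * stringMass p p K (L i - h / p i) (U i + h / p i))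
        (g := fun i => A * φ ^ (2 * (K + 1)) * h ^ (3 - θ) * (p i ^ θ / φ ^ 2 *
          stringMass p (fun i => p i ^ θ / φ ^ 2) K (L i - h / p i) (U i + h / p i)))
        (fun i _ => mul_nonneg (hp i).le (stringMass_nonneg (fun i => (hp i).le) _ _ _))
        (fun i _ => mul_nonneg (mul_nonneg (by positivity) (Real.rpow_nonneg hh0 _))
          (mul_nonneg (hm i) (stringMass_nonneg hm _ _ _)))
        (fun i _ => by
          have h2 := ih (L i) (U i) (h / p i) (hi i).1 (hi i).2
          have hpi := hp i
          have h3 : (h / p i) ^ (3 - θ) = h ^ (3 - θ) * p i ^ θ / p i ^ 3 := by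
            rw [Real.div_rpow hh0 hpi.le, Real.rpow_sub hpi, div_div_eq_mul_div]
            norm_cast
          rw [h3] at h2
          have h4 := mul_le_mul_of_nonneg_left h2 (pow_nonneg hpi.le 4)
          rw [mul_pow, ← pow_mul]
          refine h4.trans (le_of_eq ?_)
          rw [show 2 * (K + 1) = 2 * K + 2 by ring, pow_add]
          field_simp)
      rw [← mul_sum] at hcs
      refine hcs.trans (le_of_eq ?_)
      ring

theorem stringMass_le_mul (hp : ∀ i, 0 < p i) (hsum : ∑ i, p i = 1) {Pm q : ℝ}
    (hPm : ∀ i, p i ≤ Pm) (hq0 : 0 < q) (hq : ∀ i, q ≤ p i) {β : ℝ} {g : Fin k → ℝ}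
    (hg : ∀ i, 0 ≤ g i) (hgsum : ∑ i, g i = 1) (hgβ : ∀ i, g i ≤ p i ^ β) (K : ℕ) (a b h : ℝ)
    (hh : Pm ^ K ≤ h) (hh2 : h ≤ 2 / q) :
    stringMass p g K a b ≤
      max 1 ((2 / q) ^ (-(β - 1))) * h ^ (β - 1) * stringMass p p K (a - h) (b + h) := by
  have hA : 0 < max 1 ((2 / q) ^ (-(β - 1))) := lt_of_lt_of_le one_pos (le_max_left _ _)
  have hroot : ∀ K a b h, 1 ≤ h → h ≤ 2 / q → stringMass p g K a b ≤
      max 1 ((2 / q) ^ (-(β - 1))) * h ^ (β - 1) * stringMass p p K (a - h) (b + h) := by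
    intro K a b h h1 h2
    rcases stringMass_eq_zero_or hp hsum h1 g K a b with h0 | h0
    · rw [h0]
      have := stringMass_nonneg (p := p) (fun i => (hp i).le) K (a - h) (b + h)
      have := Real.rpow_nonneg (by linarith : 0 ≤ h) (β - 1)
      positivity
    · rw [h0, hsum, one_pow, mul_one]
      have h2' := stringMass_le (p := p) hg K a b
      rw [hgsum, one_pow] at h2'
      exact h2'.trans (one_le_max_mul_rpow h1 h2)
  induction K generalizing a b h with
  | zero => exact hroot 0 a b h (by simpa using hh) hh2
  | succ K ih =>
    rcases le_or_gt 1 h with h1 | h1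
    · exact hroot _ a b h h1 hh2
    · have hi : ∀ i, Pm ^ K ≤ h / p i ∧ h / p i ≤ 2 / q := by
        intro i
        have hPm0 : 0 < Pm := (hp i).trans_le (hPm i)
        constructor
        · rw [le_div_iff₀ (hp i)]
          refine le_trans ?_ hh
          rw [pow_succ]
          exact mul_le_mul_of_nonneg_left (hPm i) (by positivity)
        · exact div_le_div₀ (by norm_num) (by linarith) hq0 (hq i)
      simp only [stringMass_succ hp hsum, div_window, div_window', mul_sum]
      refine sum_le_sum fun i _ => ?_
      have hpi := hp i
      have hh0 : 0 ≤ h := le_trans (pow_nonneg (hpi.le.trans (hPm i)) _) hh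
      set L := (a - ∑ j, if j < i then p j else 0) / p i
      set U := (b - ∑ j, if j < i then p j else 0) / p i
      have h2 := ih L U (h / p i) (hi i).1 (hi i).2
      have h3 : (h / p i) ^ (β - 1) = h ^ (β - 1) * p i / p i ^ β := by
        rw [Real.div_rpow hh0 hpi.le, Real.rpow_sub hpi, div_div_eq_mul_div, Real.rpow_one]
      rw [h3] at h2
      have hpβ : 0 < p i ^ β := Real.rpow_pos_of_pos hpi _
      refine (mul_le_mul (hgβ i) h2 (stringMass_nonneg hg _ _ _) hpβ.le).trans (le_of_eq ?_)
      field_simp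

theorem strP_le {Pm : ℝ} (hp : ∀ i, 0 < p i) (hPm : ∀ i, p i ≤ Pm) {K : ℕ} (s : Str k K) :
    strP p s ≤ Pm ^ K :=
  (prod_le_prod (fun j _ => (hp _).le) fun j _ => hPm _).trans (by simp)

theorem cumul_add_sum_le (hp : ∀ i, 0 < p i) {K : ℕ} {s₁ s₂ : Str k K} {S : Finset (Str k K)}
    (hne : S.Nonempty) (hS : ∀ s ∈ S, lexVal s₁ ≤ lexVal s ∧ lexVal s ≤ lexVal s₂) :
    cumul p s₁ + ∑ s ∈ S, strP p s ≤ cumul p s₂ + strP p s₂ := by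
  have hw : ∀ s : Str k K, 0 ≤ strP p s := fun s => prod_nonneg fun j _ => (hp _).le
  have hins : cumul p s₂ + strP p s₂ =
      ∑ s ∈ insert s₂ (univ.filter fun c => lexVal c < lexVal s₂), strP p s := by
    rw [sum_insert (by simp), cumul, sum_filter, add_comm]
  have hdisj : Disjoint (univ.filter fun c => lexVal c < lexVal s₁) S := by
    rw [disjoint_left]
    intro s hs hs'
    rw [mem_filter_univ] at hs
    exact absurd (hS s hs').1 (not_le.2 hs)
  rw [hins, cumul, ← sum_filter, ← sum_union hdisj]
  obtain ⟨s₀, hs₀⟩ := hne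
  refine sum_le_sum_of_subset_of_nonneg (fun s hs => ?_) fun s _ _ => hw s
  rw [mem_insert, mem_filter_univ]
  have hle : lexVal s ≤ lexVal s₂ := by
    rcases mem_union.1 hs with h | h
    · rw [mem_filter_univ] at h
      have := hS s₀ hs₀
      omega
    · exact (hS s h).2
  rcases hle.eq_or_lt with h | h
  · exact Or.inl (lexVal_injective h)
  · exact Or.inr h

theorem stringMass_self_le {Pm : ℝ} (hp : ∀ i, 0 < p i) (hPm : ∀ i, p i ≤ Pm)
    (hPm0 : 0 ≤ Pm) (K : ℕ) {a b : ℝ}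
    (hab : a ≤ b) : stringMass p p K a b ≤ b - a + Pm ^ K := by
  set S : Finset (Str k K) := univ.filter fun s => a ≤ cumul p s ∧ cumul p s ≤ b with hS
  have hSsum : stringMass p p K a b = ∑ s ∈ S, strP p s := by rw [hS, sum_filter]; rfl
  rw [hSsum]
  rcases S.eq_empty_or_nonempty with h | h
  · rw [h, sum_empty]
    have := pow_nonneg hPm0 K
    linarith
  · obtain ⟨s₁, h1, h1'⟩ := exists_min_image S lexVal h
    obtain ⟨s₂, h2, h2'⟩ := exists_max_image S lexVal h
    have h3 := cumul_add_sum_le hp h fun s hs => ⟨h1' s hs, h2' s hs⟩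
    have h4 := strP_le hp hPm s₂
    rw [hS, mem_filter] at h1 h2
    linarith [h1.2.1, h2.2.2]

end StringMass

section DyadicSum

theorem rpow_le_two_rpow_abs {y e : ℝ} (h1 : 1 ≤ y) (h2 : y ≤ 2) : y ^ e ≤ 2 ^ |e| :=
  (Real.rpow_le_rpow_of_exponent_le h1 (le_abs_self e)).trans
    (Real.rpow_le_rpow (by linarith) h2 (abs_nonneg e))

variable {k : ℕ} {p : Fin k → ℝ}

theorem sum_stringMass_windows_le {g : Fin k → ℝ} (hg : ∀ i, 0 ≤ g i) (K j : ℕ) {f₀ η : ℝ}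
    (hη : 0 < η) (S : Finset ℕ) (hS : ∀ l ∈ S, 1 ≤ l ∧ l < 2 ^ (j + 1)) :
    ∑ l ∈ S, stringMass p g K (f₀ + ((l : ℝ) ^ 2 - 1 - l) * η) (f₀ + ((l : ℝ) ^ 2 + 3 * l) * η) ≤
      2 * stringMass p g K (f₀ - η) (f₀ + 10 * 4 ^ j * η) := by
  simp only [stringMass]
  rw [sum_comm, mul_sum]
  refine sum_le_sum fun s _ => ?_
  have hprod : 0 ≤ ∏ j, g (s j) := prod_nonneg fun _ _ => hg _
  rw [← sum_filter, sum_const, nsmul_eq_mul]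
  set T := S.filter fun l : ℕ => f₀ + ((l : ℝ) ^ 2 - 1 - l) * η ≤ cumul p s ∧
    cumul p s ≤ f₀ + ((l : ℝ) ^ 2 + 3 * l) * η with hT
  rcases T.eq_empty_or_nonempty with h | h
  · rw [h, card_empty, Nat.cast_zero, zero_mul]
    split_ifs <;> simp [hprod]
  obtain ⟨l₀, hl₀, hmin⟩ := exists_min_image T id h
  have hsub : T ⊆ {l₀, l₀ + 1} := by
    intro l hl
    have hle : l₀ ≤ l := hmin l hl
    rw [mem_insert, mem_singleton]
    by_contra hcon
    have h2 : l₀ + 2 ≤ l := by omega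
    have h2' : (l₀ : ℝ) + 2 ≤ l := by exact_mod_cast h2
    have h3 := (mem_filter.1 hl).2.1
    have h4 := (mem_filter.1 hl₀).2.2
    have h5 : ((l : ℝ) ^ 2 - 1 - l) * η ≤ ((l₀ : ℝ) ^ 2 + 3 * l₀) * η := by linarith
    have h6 := le_of_mul_le_mul_right h5 hη
    have h7 : (0 : ℝ) ≤ l₀ := Nat.cast_nonneg _
    nlinarith
  have hcard : (#T : ℝ) ≤ 2 := by
    exact_mod_cast (card_le_card hsub).trans (card_le_two)
  obtain ⟨hl₀S, h1, h2⟩ := mem_filter.1 hl₀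
  obtain ⟨h3, h4⟩ := hS l₀ hl₀S
  have h3' : (1 : ℝ) ≤ l₀ := by exact_mod_cast h3
  have h4' : (l₀ : ℝ) ≤ 2 * 2 ^ j := by
    have : (l₀ : ℝ) ≤ 2 ^ (j + 1) := by exact_mod_cast h4.le
    rwa [pow_succ'] at this
  have h5 : (1 : ℝ) ≤ 2 ^ j := one_le_pow₀ (by norm_num)
  have h6 : (4 : ℝ) ^ j = 2 ^ j * 2 ^ j := by rw [← mul_pow]; norm_num
  rw [if_pos]
  · exact mul_le_mul_of_nonneg_right hcard hprod
  constructor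
  · refine le_trans ?_ h1
    have h7 : 0 ≤ ((l₀ : ℝ) ^ 2 - l₀) * η := mul_nonneg (by nlinarith) hη.le
    linarith
  · refine h2.trans (add_le_add le_rfl (mul_le_mul_of_nonneg_right ?_ hη.le))
    rw [h6]
    nlinarith

theorem sum_sq_div_le (hp : ∀ i, 0 < p i) (hsum : ∑ i, p i = 1) {Pm q : ℝ}
    (hPm : ∀ i, p i ≤ Pm) (hPm0 : 0 ≤ Pm) (hq0 : 0 < q) (hq : ∀ i, q ≤ p i) {θ β : ℝ}
    (hθ : ∑ i, p i ^ θ = (∑ i, p i ^ 2) ^ 2) (hne : 0 < ∑ i, p i ^ 2)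
    (hβ : ∀ i, p i ^ θ / (∑ i, p i ^ 2) ^ 2 ≤ p i ^ β) (K L : ℕ) {f₀ η : ℝ}
    (hη : 0 < η) (hKη : Pm ^ K ≤ η) (hLη : (L : ℝ) ^ 2 * η ≤ 2 / q) {ν : ℕ → ℝ}
    (hν0 : ∀ l ∈ Icc 1 L, 0 ≤ ν l) (hν : ∀ l ∈ Icc 1 L, ν l ≤ stringMass p (fun i => p i ^ 2) K
      (f₀ + ((l : ℝ) ^ 2 - 1) * η) (f₀ + ((l : ℝ) ^ 2 + 2 * l) * η)) :
    ∑ l ∈ Icc 1 L, ν l ^ 2 / l ≤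
      168 * max 1 ((2 / q) ^ (-(3 - θ))) * max 1 ((2 / q) ^ (-(β - 1))) * 2 ^ |3 - θ| *
        (∑ i, p i ^ 2) ^ (2 * K) * η ^ (4 - θ + β) *
        ∑ j ∈ range (Nat.log 2 L + 1), ((4 : ℝ) ^ j) ^ ((3 - θ) / 2 + β) := by
  set A := max 1 ((2 / q) ^ (-(3 - θ))) with hA
  set A' := max 1 ((2 / q) ^ (-(β - 1))) with hA'
  set φ := ∑ i, p i ^ 2 with hφ
  have hA0 : 0 < A := lt_of_lt_of_le one_pos (le_max_left _ _)
  have hA0' : 0 < A' := lt_of_lt_of_le one_pos (le_max_left _ _)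
  have hm : ∀ i, 0 ≤ p i ^ θ / φ ^ 2 := fun i => by
    have := hp i
    positivity
  have hmsum : ∑ i, p i ^ θ / φ ^ 2 = 1 := by
    rw [← sum_div, hθ, div_self (by positivity)]
  set mass := stringMass p (fun i => p i ^ θ / φ ^ 2) K with hmass
  have hterm : ∀ l ∈ Icc 1 L, ν l ^ 2 / l ≤ 6 * A * φ ^ (2 * K) * η ^ (4 - θ) * (l ^ (3 - θ) *
      mass (f₀ + ((l : ℝ) ^ 2 - 1 - l) * η) (f₀ + ((l : ℝ) ^ 2 + 3 * l) * η)) := by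
    intro l hl
    obtain ⟨hl1, hlL⟩ := mem_Icc.1 hl
    have hl1' : (1 : ℝ) ≤ l := by exact_mod_cast hl1
    have hlL' : (l : ℝ) ≤ L := by exact_mod_cast hlL
    have hl0 : (0 : ℝ) < l := by linarith
    have h1 : η ≤ l * η := by nlinarith
    have h2 := stringMass_sq_le hp hsum hPm hq0 hq hθ hne K (f₀ + ((l : ℝ) ^ 2 - 1) * η)
      (f₀ + ((l : ℝ) ^ 2 + 2 * l) * η) (l * η) (hKη.trans h1)
      (le_trans (mul_le_mul_of_nonneg_right (by nlinarith) hη.le) hLη)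
    rw [show f₀ + ((l : ℝ) ^ 2 - 1) * η - l * η = f₀ + ((l : ℝ) ^ 2 - 1 - l) * η by ring,
      show f₀ + ((l : ℝ) ^ 2 + 2 * l) * η + l * η = f₀ + ((l : ℝ) ^ 2 + 3 * l) * η by ring] at h2
    have h3 := stringMass_self_le hp hPm hPm0 K (a := f₀ + ((l : ℝ) ^ 2 - 1 - l) * η)
      (b := f₀ + ((l : ℝ) ^ 2 + 3 * l) * η)
      (add_le_add le_rfl (mul_le_mul_of_nonneg_right (by linarith) hη.le))
    have h4 : stringMass p p K (f₀ + ((l : ℝ) ^ 2 - 1 - l) * η)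
        (f₀ + ((l : ℝ) ^ 2 + 3 * l) * η) ≤ 6 * (l * η) := by nlinarith
    have h5 : 0 ≤ mass (f₀ + ((l : ℝ) ^ 2 - 1 - l) * η) (f₀ + ((l : ℝ) ^ 2 + 3 * l) * η) :=
      stringMass_nonneg hm _ _ _
    have h6 : (l * η) ^ (3 - θ) * (l * η) = l * (η ^ (4 - θ) * l ^ (3 - θ)) := by
      rw [Real.mul_rpow hl0.le hη.le, show 4 - θ = 3 - θ + 1 by ring, Real.rpow_add_one hη.ne']
      ring
    rw [div_le_iff₀ hl0]
    calc ν l ^ 2 ≤ _ := pow_le_pow_left₀ (hν0 l hl) (hν l hl) 2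
      _ ≤ _ := h2
      _ ≤ A * φ ^ (2 * K) * (l * η) ^ (3 - θ) * (6 * (l * η)) *
          mass (f₀ + ((l : ℝ) ^ 2 - 1 - l) * η) (f₀ + ((l : ℝ) ^ 2 + 3 * l) * η) := by
        gcongr
      _ = 6 * A * φ ^ (2 * K) * ((l * η) ^ (3 - θ) * (l * η)) *
          mass (f₀ + ((l : ℝ) ^ 2 - 1 - l) * η) (f₀ + ((l : ℝ) ^ 2 + 3 * l) * η) := by ring
      _ = _ := by rw [h6]; ring
  have hmaps : ∀ l ∈ Icc 1 L, Nat.log 2 l ∈ range (Nat.log 2 L + 1) := by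
    intro l hl
    rw [mem_range, Nat.lt_succ_iff]
    exact Nat.log_mono_right (mem_Icc.1 hl).2
  have hblock : ∀ j ∈ range (Nat.log 2 L + 1), ∑ l ∈ Icc 1 L with Nat.log 2 l = j, (l : ℝ) ^ (3 - θ) *
      mass (f₀ + ((l : ℝ) ^ 2 - 1 - l) * η) (f₀ + ((l : ℝ) ^ 2 + 3 * l) * η) ≤
      28 * A' * 2 ^ |3 - θ| * η ^ β * ((4 : ℝ) ^ j) ^ ((3 - θ) / 2 + β) := by
    intro j hj
    have h2j : (0 : ℝ) < 2 ^ j := by positivity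
    have h4j : (1 : ℝ) ≤ 4 ^ j := one_le_pow₀ (by norm_num)
    have hbd : ∀ l ∈ (Icc 1 L).filter (fun l => Nat.log 2 l = j),
        1 ≤ l ∧ l < 2 ^ (j + 1) ∧ 2 ^ j ≤ l := by
      intro l hl
      obtain ⟨h1, h2⟩ := mem_filter.1 hl
      have h3 := (mem_Icc.1 h1).1
      have := (Nat.log_eq_iff (Or.inr ⟨one_lt_two, by omega⟩)).1 h2
      exact ⟨h3, this.2, this.1⟩
    rcases ((Icc 1 L).filter (fun l => Nat.log 2 l = j)).eq_empty_or_nonempty with he | ⟨l₁, hl₁⟩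
    · rw [he, sum_empty]
      positivity
    have hh : (4 : ℝ) ^ j * η ≤ 2 / q := by
      refine le_trans (mul_le_mul_of_nonneg_right ?_ hη.le) hLη
      have h1 : 2 ^ j ≤ L := (hbd l₁ hl₁).2.2.trans (mem_Icc.1 (mem_filter.1 hl₁).1).2
      have h2 : (2 : ℝ) ^ j ≤ L := by exact_mod_cast h1
      calc (4 : ℝ) ^ j = (2 ^ j) ^ 2 := by rw [← pow_mul, mul_comm, pow_mul]; norm_num
        _ ≤ _ := pow_le_pow_left₀ h2j.le h2 2
    have hηh : η ≤ 4 ^ j * η := by nlinarith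
    have hD : mass (f₀ - η) (f₀ + 10 * 4 ^ j * η) ≤ 14 * A' * (4 ^ j * η) ^ β := by
      have h1 := stringMass_le_mul hp hsum hPm hq0 hq hm hmsum hβ K (f₀ - η)
        (f₀ + 10 * 4 ^ j * η) (4 ^ j * η) (hKη.trans hηh) hh
      have h2 := stringMass_self_le hp hPm hPm0 K (a := f₀ - η - 4 ^ j * η)
        (b := f₀ + 10 * 4 ^ j * η + 4 ^ j * η) (by nlinarith)
      have h3 : stringMass p p K (f₀ - η - 4 ^ j * η) (f₀ + 10 * 4 ^ j * η + 4 ^ j * η) ≤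
          14 * (4 ^ j * η) := by linarith
      refine h1.trans ((mul_le_mul_of_nonneg_left h3 (by positivity)).trans (le_of_eq ?_))
      have h4 : ((4 : ℝ) ^ j * η) ^ β = (4 ^ j * η) ^ (β - 1) * (4 ^ j * η) := by
        rw [← Real.rpow_add_one (by positivity), sub_add_cancel]
      rw [h4]
      ring
    calc ∑ l ∈ Icc 1 L with Nat.log 2 l = j, (l : ℝ) ^ (3 - θ) *
          mass (f₀ + ((l : ℝ) ^ 2 - 1 - l) * η) (f₀ + ((l : ℝ) ^ 2 + 3 * l) * η)
        ≤ ∑ l ∈ Icc 1 L with Nat.log 2 l = j, (2 ^ j : ℝ) ^ (3 - θ) * 2 ^ |3 - θ| *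
          mass (f₀ + ((l : ℝ) ^ 2 - 1 - l) * η) (f₀ + ((l : ℝ) ^ 2 + 3 * l) * η) := by
          refine sum_le_sum fun l hl => mul_le_mul_of_nonneg_right ?_ (stringMass_nonneg hm _ _ _)
          obtain ⟨-, h2, h3⟩ := hbd l hl
          have h2' : (l : ℝ) ≤ 2 * 2 ^ j := by
            have : (l : ℝ) ≤ 2 ^ (j + 1) := by exact_mod_cast h2.le
            rwa [pow_succ'] at this
          have h3' : (2 : ℝ) ^ j ≤ l := by exact_mod_cast h3
          rw [← mul_div_cancel₀ (l : ℝ) h2j.ne',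
            Real.mul_rpow h2j.le (by positivity)]
          refine mul_le_mul_of_nonneg_left (rpow_le_two_rpow_abs ?_ ?_) (by positivity)
          · rwa [one_le_div h2j]
          · rwa [div_le_iff₀ h2j]
      _ ≤ (2 ^ j : ℝ) ^ (3 - θ) * 2 ^ |3 - θ| * (2 * (14 * A' * (4 ^ j * η) ^ β)) := by
          rw [← mul_sum]
          refine mul_le_mul_of_nonneg_left ?_ (by positivity)
          refine (sum_stringMass_windows_le hm K j hη _ fun l hl =>
            ⟨(hbd l hl).1, (hbd l hl).2.1⟩).trans ?_
          exact mul_le_mul_of_nonneg_left hD (by norm_num)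
      _ = 28 * A' * 2 ^ |3 - θ| * η ^ β * ((4 : ℝ) ^ j) ^ ((3 - θ) / 2 + β) := by
          have h1 : (2 ^ j : ℝ) ^ (3 - θ) = ((4 : ℝ) ^ j) ^ ((3 - θ) / 2) := by
            rw [show (4 : ℝ) ^ j = (2 ^ j) ^ (2 : ℝ) by
              rw [Real.rpow_two, ← pow_mul, mul_comm, pow_mul]; norm_num,
              ← Real.rpow_mul h2j.le]
            congr 1
            ring
          rw [h1, Real.mul_rpow (by positivity) hη.le, Real.rpow_add (by positivity)]
          ring
  calc ∑ l ∈ Icc 1 L, ν l ^ 2 / l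
      ≤ 6 * A * φ ^ (2 * K) * η ^ (4 - θ) * ∑ l ∈ Icc 1 L, ((l : ℝ) ^ (3 - θ) *
      mass (f₀ + ((l : ℝ) ^ 2 - 1 - l) * η) (f₀ + ((l : ℝ) ^ 2 + 3 * l) * η)) := by
        rw [mul_sum]
        exact sum_le_sum hterm
    _ ≤ 6 * A * φ ^ (2 * K) * η ^ (4 - θ) * ∑ j ∈ range (Nat.log 2 L + 1),
        28 * A' * 2 ^ |3 - θ| * η ^ β * ((4 : ℝ) ^ j) ^ ((3 - θ) / 2 + β) := by
        rw [← sum_fiberwise_of_maps_to hmaps]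
        exact mul_le_mul_of_nonneg_left (sum_le_sum hblock) (by positivity)
    _ = _ := by
        rw [← mul_sum, Real.rpow_add hη]
        ring

end DyadicSum

section ForwardEdges

variable {k : ℕ} {p : Fin k → ℝ}

theorem tailMass_lexVal (hsum : ∑ i, p i = 1) {K : ℕ} (b : Str k K) :
    tailMass lexVal (strP (K := K) p) (lexVal b) = 1 - cumul p b := by
  rw [eq_sub_iff_add_eq, ← sum_strP hsum K, tailMass, cumul, ← sum_add_distrib]
  refine sum_congr rfl fun a _ => ?_
  rw [tailWeight]
  split_ifs with h1 h2 h2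
  · omega
  · simp
  · simp
  · omega

theorem midMass_eq {α : Type} [Fintype α] [DecidableEq α] {v : α → ℕ} (hv : Function.Injective v)
    (w : α → ℝ) {u : ℕ} {b : α} (hb : u ≤ v b) :
    midMass v w u b = tailMass v w u - tailMass v w (v b) + w b := by
  have h : w b = ∑ a, if a = b then w a else 0 := by simp
  rw [h, midMass, tailMass, tailMass, ← sum_sub_distrib, ← sum_add_distrib]
  refine sum_congr rfl fun a _ => ?_
  rw [tailWeight, tailWeight]
  have hab : a = b ↔ v a = v b := hv.eq_iff.symm
  simp only [hab]
  split_ifs <;> first | omega | simp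

theorem tailMass_anti {α : Type} [Fintype α] {v : α → ℕ} {w : α → ℝ} (hw : ∀ a, 0 ≤ w a)
    {u u' : ℕ} (h : u ≤ u') : tailMass v w u' ≤ tailMass v w u := by
  refine sum_le_sum fun a _ => ?_
  rw [tailWeight, tailWeight]
  split_ifs
  · exact le_rfl
  · omega
  · exact hw a
  · exact le_rfl

theorem sum_lt_add_self_le (hp : ∀ i, 0 < p i) (hsum : ∑ i, p i = 1) {i d : Fin k} (h : i < d) :
    (∑ j, if j < i then p j else 0) + p i ≤ 1 - p d := by
  have h1 : ∀ c : Fin k, p c = ∑ j, if j = c then p j else 0 := fun c => by simp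
  rw [h1 i, h1 d, ← hsum, ← sum_add_distrib, ← sum_sub_distrib]
  refine sum_le_sum fun j _ => ?_
  have := (hp j).le
  split_ifs <;> first | omega | simp [this]

theorem cumul_cons_le_of_lt (hp : ∀ i, 0 < p i) (hsum : ∑ i, p i = 1) {K : ℕ} {i d : Fin k}
    (h : i < d) (s : Str k K) : cumul p (Fin.cons i s : Str k (K + 1)) ≤ 1 - p d := by
  rw [cumul_cons hsum]
  have h1 := sum_lt_add_self_le hp hsum h
  have h2 := mul_le_of_le_one_right (hp i).le (cumul_le_one hp hsum s)
  linarith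

theorem cumul_le_of_not_beginsWith2 (hp : ∀ i, 0 < p i) (hsum : ∑ i, p i = 1) {K : ℕ}
    (hK : 2 ≤ K) {d : Fin k} (hd : ∀ i, i ≤ d) {b : Str k K} (hb : ¬ beginsWith2 d b) :
    cumul p b ≤ 1 - p d ^ 2 := by
  obtain ⟨K, rfl⟩ : ∃ K', K = K' + 1 + 1 := ⟨K - 2, by omega⟩
  have hd1 : p d ≤ 1 := by
    rw [← hsum]
    exact single_le_sum (fun i _ => (hp i).le) (mem_univ d)
  have hd0 := hp d
  induction b using Fin.consCases with
  | cons i s =>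
  induction s using Fin.consCases with
  | cons i' s =>
  rcases (hd i).lt_or_eq with h | rfl
  · refine (cumul_cons_le_of_lt hp hsum h _).trans ?_
    nlinarith
  · have hi' : i' < i := (hd i').lt_of_ne fun h => hb ⟨by omega, rfl, Eq.trans (b := i') (by rfl) h⟩
    have h1 := cumul_cons_le_of_lt hp hsum hi' s
    have h2 : (∑ j, if j < i then p j else 0) ≤ 1 - p i := by
      rw [le_sub_iff_add_le]
      have h3 : p i = ∑ j, if j = i then p j else 0 := by simp
      rw [h3, ← hsum, ← sum_add_distrib]
      refine sum_le_sum fun j _ => ?_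
      have := (hp j).le
      split_ifs <;> first | omega | simp [this]
    rw [cumul_cons hsum]
    nlinarith

theorem strP_eq_prod_sq {K : ℕ} (b : Str k K) : strP p b ^ 2 = ∏ j, p (b j) ^ 2 := by
  rw [strP, prod_pow]

theorem sum_sq_midMass_le (hp : ∀ i, 0 < p i) (hsum : ∑ i, p i = 1) {Pm q : ℝ}
    (hPm : ∀ i, p i ≤ Pm) (hPm0 : 0 ≤ Pm) (hq0 : 0 < q) (hq : ∀ i, q ≤ p i) {θ β : ℝ}
    (hθ : ∑ i, p i ^ θ = (∑ i, p i ^ 2) ^ 2)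
    (hβ : ∀ i, p i ^ θ / (∑ i, p i ^ 2) ^ 2 ≤ p i ^ β) {d : Fin k} (hd : ∀ i, i ≤ d) :
    ∃ C, 0 < C ∧ ∀ K u m : ℕ, 2 ≤ K → Pm ^ K ≤ p d ^ 2 / (m + 1) →
      (u = 0 ∨ ∃ b : Str k K, ¬ beginsWith2 d b ∧ u = lexVal b) →
      p d ^ 2 ≤ tailMass lexVal (strP (K := K) p) u ∧
      ∑ j ∈ range (m + 1), (∑ b : Str k K with ¬ beginsWith2 d b ∧ u ≤ lexVal b,
        (m + 2 : ℝ) ^ 2 * m.choose j * (strP p b ^ 2 * midMass lexVal (strP p) u b ^ j *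
          tailMass lexVal (strP (K := K) p) (lexVal b) ^ (m - j))) ^ 2 ≤
      (m + 2 : ℝ) ^ 4 * tailMass lexVal (strP (K := K) p) u ^ (2 * m) *
        (C * (∑ i, p i ^ 2) ^ (2 * K) *
          (tailMass lexVal (strP (K := K) p) u / (m + 1)) ^ (4 - θ + β) *
          ∑ j ∈ range (Nat.log 2 (Nat.sqrt (m + 2)) + 1), ((4 : ℝ) ^ j) ^ ((3 - θ) / 2 + β)) := by
  set κ := p d ^ 2 with hκ
  have hκ0 : 0 < κ := pow_pos (hp d) 2
  have hne : 0 < ∑ i, p i ^ 2 := sum_pos (fun i _ => pow_pos (hp i) 2) ⟨d, mem_univ d⟩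
  have hd1 : p d ≤ 1 := by
    rw [← hsum]
    exact single_le_sum (fun i _ => (hp i).le) (mem_univ d)
  have hκ1 : κ ≤ 1 := pow_le_one₀ (hp d).le hd1
  have hq1 : q ≤ 1 := (hq d).trans hd1
  refine ⟨4 * Real.exp 7 / √κ * (168 * max 1 ((2 / q) ^ (-(3 - θ))) *
    max 1 ((2 / q) ^ (-(β - 1))) * 2 ^ |3 - θ|), ?_, fun K u m hK hPK hu => ?_⟩
  · have h1 : 0 < max 1 ((2 / q) ^ (-(3 - θ))) := lt_of_lt_of_le one_pos (le_max_left _ _)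
    have h2 : 0 < max 1 ((2 / q) ^ (-(β - 1))) := lt_of_lt_of_le one_pos (le_max_left _ _)
    positivity
  have hw : ∀ b : Str k K, 0 ≤ strP p b := fun b => prod_nonneg fun i _ => (hp _).le
  set W := tailMass lexVal (strP (K := K) p) u with hW
  have hWone : W ≤ 1 := by
    rw [← sum_strP hsum K]
    refine sum_le_sum fun a _ => ?_
    rw [tailWeight]
    split_ifs
    exacts [le_rfl, hw a]
  have hWκ : κ ≤ W := by
    rcases hu with rfl | ⟨b, hb, rfl⟩
    · have : W = 1 := by
        rw [hW, ← sum_strP hsum K, tailMass]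
        simp [tailWeight]
      linarith
    · rw [hW, tailMass_lexVal hsum]
      have := cumul_le_of_not_beginsWith2 hp hsum hK hd hb
      linarith
  refine ⟨hWκ, ?_⟩
  have hW0 : 0 < W := hκ0.trans_le hWκ
  have hM : (0 : ℝ) < m + 1 := by positivity
  set B : Finset (Str k K) := {b : Str k K | ¬ beginsWith2 d b ∧ u ≤ lexVal b} with hB
  set x : Str k K → ℝ := fun b => (W - tailMass lexVal (strP p) (lexVal b)) / W with hx
  have hx0 : ∀ b ∈ B, 0 ≤ x b := fun b hb =>
    div_nonneg (sub_nonneg.2 (tailMass_anti hw (mem_filter.1 hb).2.2)) hW0.le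
  have hx1 : ∀ b ∈ B, x b ≤ 1 - κ := by
    intro b hb
    rw [hx, div_le_iff₀ hW0, tailMass_lexVal hsum]
    have := cumul_le_of_not_beginsWith2 hp hsum hK hd (mem_filter.1 hb).2.1
    nlinarith
  have hPW : Pm ^ K ≤ W / (m + 1) := hPK.trans (by gcongr)
  have hterm : ∀ j ∈ range (m + 1), ∀ b ∈ B, (m + 2 : ℝ) ^ 2 * m.choose j *
      (strP p b ^ 2 * midMass lexVal (strP p) u b ^ j *
        tailMass lexVal (strP (K := K) p) (lexVal b) ^ (m - j)) ≤
      (m + 2 : ℝ) ^ 2 * W ^ m * (strP p b ^ 2 * binomKernel m (x b) j) := by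
    intro j hj b hb
    have hjm : j ≤ m := Nat.lt_succ_iff.1 (mem_range.1 hj)
    have hxW : W * x b = W - tailMass lexVal (strP p) (lexVal b) := mul_div_cancel₀ _ hW0.ne'
    have h1 : midMass lexVal (strP p) u b ≤ W * (x b + 1 / (m + 1)) := by
      rw [midMass_eq lexVal_injective _ (mem_filter.1 hb).2.2, mul_add, hxW, mul_one_div]
      have := (strP_le hp hPm b).trans hPW
      linarith
    have h2 : tailMass lexVal (strP (K := K) p) (lexVal b) ≤ W * (1 - x b + 1 / (m + 1)) := by
      have : 0 ≤ W * (1 / ((m : ℝ) + 1)) := by positivity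
      linarith
    have h3 : W ^ m = W ^ j * W ^ (m - j) := by rw [← pow_add, Nat.add_sub_cancel' hjm]
    have h4 : midMass lexVal (strP p) u b ^ j * tailMass lexVal (strP (K := K) p) (lexVal b) ^ (m - j) ≤
        (W * (x b + 1 / (m + 1))) ^ j * (W * (1 - x b + 1 / (m + 1))) ^ (m - j) := by
      have h5 := midMass_nonneg (v := lexVal) hw u b
      have h6 := tailMass_nonneg (v := lexVal) hw (lexVal b)
      exact mul_le_mul (pow_le_pow_left₀ h5 h1 j) (pow_le_pow_left₀ h6 h2 _) (pow_nonneg h6 _)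
        (pow_nonneg (h5.trans h1) j)
    calc _ = (m + 2 : ℝ) ^ 2 * m.choose j * strP p b ^ 2 * (midMass lexVal (strP p) u b ^ j *
          tailMass lexVal (strP (K := K) p) (lexVal b) ^ (m - j)) := by ring
      _ ≤ (m + 2 : ℝ) ^ 2 * m.choose j * strP p b ^ 2 *
          ((W * (x b + 1 / (m + 1))) ^ j * (W * (1 - x b + 1 / (m + 1))) ^ (m - j)) := by
          gcongr
      _ = _ := by
          rw [h3, mul_pow, mul_pow, binomKernel]
          ring
  have hstep1 : ∑ j ∈ range (m + 1), (∑ b ∈ B, (m + 2 : ℝ) ^ 2 * m.choose j *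
      (strP p b ^ 2 * midMass lexVal (strP p) u b ^ j *
        tailMass lexVal (strP (K := K) p) (lexVal b) ^ (m - j))) ^ 2 ≤
      (m + 2 : ℝ) ^ 4 * W ^ (2 * m) *
        ∑ j ∈ range (m + 1), (∑ b ∈ B, strP p b ^ 2 * binomKernel m (x b) j) ^ 2 := by
    rw [mul_sum]
    refine sum_le_sum fun j hj => ?_
    have h1 : (m + 2 : ℝ) ^ 4 * W ^ (2 * m) = ((m + 2 : ℝ) ^ 2 * W ^ m) ^ 2 := by ring
    rw [h1, ← mul_pow, mul_sum]
    refine pow_le_pow_left₀ (sum_nonneg fun b _ => ?_) (sum_le_sum (hterm j hj)) 2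
    have h5 := midMass_nonneg (v := lexVal) hw u b
    have h6 := tailMass_nonneg (v := lexVal) hw (lexVal b)
    positivity
  have hη : 0 < W / ((m : ℝ) + 1) := by positivity
  have hLη : ((Nat.sqrt (m + 2) : ℕ) : ℝ) ^ 2 * (W / (m + 1)) ≤ 2 / q := by
    have h1 : ((Nat.sqrt (m + 2) : ℕ) : ℝ) ^ 2 ≤ m + 2 := by
      exact_mod_cast Nat.sqrt_le' (m + 2)
    have h2 : ((Nat.sqrt (m + 2) : ℕ) : ℝ) ^ 2 * (W / (m + 1)) ≤ (m + 2) * (1 / (m + 1)) := by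
      gcongr
    have h3 : ((m : ℝ) + 2) * (1 / (m + 1)) ≤ 2 := by
      rw [mul_one_div, div_le_iff₀ hM]
      have : (0 : ℝ) ≤ m := Nat.cast_nonneg m
      linarith
    have h4 : 2 ≤ 2 / q := by
      rw [le_div_iff₀ hq0]
      linarith
    linarith
  have hstep2 := sum_sq_sum_binomKernel_le B hκ0 (fun b _ => sq_nonneg (strP p b)) hx0 hx1 m
  have hstep3 := sum_sq_div_le hp hsum hPm hPm0 hq0 hq hθ hne hβ K (Nat.sqrt (m + 2))
    (f₀ := 1 - W) hη hPW hLη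
    (ν := fun l => ∑ b ∈ B with ⌊√((m + 1) * x b + 1)⌋₊ = l, strP p b ^ 2)
    (fun l _ => sum_nonneg fun b _ => sq_nonneg _) (by
      intro l hl
      rw [stringMass, ← sum_filter]
      simp only [strP_eq_prod_sq]
      refine sum_le_sum_of_subset_of_nonneg ?_ fun b _ _ =>
        prod_nonneg fun j _ => sq_nonneg _
      intro b hb
      obtain ⟨hbB, hbl⟩ := mem_filter.1 hb
      have hx0b := hx0 b hbB
      have hl1 : l ≠ 0 := by
        have := (mem_Icc.1 hl).1
        omega
      obtain ⟨h1, h2⟩ := (Nat.floor_eq_iff' hl1).1 hbl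
      rw [Real.le_sqrt' (by positivity)] at h1
      rw [Real.sqrt_lt' (by positivity)] at h2
      have h3 : cumul p b = 1 - W + (m + 1) * x b * (W / (m + 1)) := by
        simp only [hx]
        rw [tailMass_lexVal hsum]
        field_simp
        ring
      rw [mem_filter, h3]
      refine ⟨mem_univ _, ?_, ?_⟩
      · gcongr
        linarith
      · gcongr
        nlinarith)
  refine hstep1.trans (mul_le_mul_of_nonneg_left (hstep2.trans ?_) (by positivity))
  refine (mul_le_mul_of_nonneg_left hstep3 (by positivity)).trans (le_of_eq ?_)
  ring

end ForwardEdges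

section Rate

variable {k : ℕ} {p : Fin k → ℝ}

theorem natLog_sqrt_add_one_le {e : ℝ} (he : 0 < e) {m N : ℕ} (hmN : m + 2 ≤ N) :
    (Nat.log 2 (Nat.sqrt (m + 2)) : ℝ) + 1 ≤ (1 / (e * Real.log 2) + 1) * (N : ℝ) ^ e := by
  have hN : (1 : ℝ) ≤ N := by exact_mod_cast (by omega : 1 ≤ N)
  have h1 : (Nat.log 2 (Nat.sqrt (m + 2)) : ℝ) ≤ Nat.log 2 N := by
    exact_mod_cast Nat.log_mono_right ((Nat.sqrt_le_self _).trans hmN)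
  have h2 := Real.natLog_le_logb N 2
  rw [Real.logb, Nat.cast_ofNat] at h2
  have h3 := Real.log_le_rpow_div (Nat.cast_nonneg N) he
  have h4 : Real.log N / Real.log 2 ≤ (N : ℝ) ^ e / e / Real.log 2 :=
    div_le_div_of_nonneg_right h3 (Real.log_pos one_lt_two).le
  have h5 : (1 : ℝ) ≤ (N : ℝ) ^ e := Real.one_le_rpow hN he.le
  have h6 : (N : ℝ) ^ e / e / Real.log 2 = 1 / (e * Real.log 2) * (N : ℝ) ^ e := by
    rw [div_div, one_div_mul_eq_div]
  linarith

theorem rpow_mul_four_pow_rpow_le {σ γ ρ : ℝ} (h1 : σ ≤ ρ) (h2 : σ + γ ≤ ρ) {m j : ℕ}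
    (hj : j ≤ Nat.log 2 (Nat.sqrt (m + 2))) :
    (m + 1 : ℝ) ^ σ * ((4 : ℝ) ^ j) ^ γ ≤ 2 ^ |γ| * (m + 1 : ℝ) ^ ρ := by
  have hM : (1 : ℝ) ≤ m + 1 := by
    have : (0 : ℝ) ≤ m := Nat.cast_nonneg m
    linarith
  have h4j : (1 : ℝ) ≤ 4 ^ j := one_le_pow₀ (by norm_num)
  rcases le_total 0 γ with hγ | hγ
  · have h3 : 4 ^ j ≤ m + 2 := by
      have h4 : 2 ^ j ≤ Nat.sqrt (m + 2) :=
        (Nat.pow_le_pow_right two_pos hj).trans (Nat.pow_log_le_self 2 (Nat.sqrt_pos.2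
          (by omega)).ne')
      calc 4 ^ j = 2 ^ j * 2 ^ j := by rw [← mul_pow]; norm_num
        _ ≤ Nat.sqrt (m + 2) * Nat.sqrt (m + 2) := Nat.mul_le_mul h4 h4
        _ ≤ m + 2 := Nat.sqrt_le _
    have h3' : (4 : ℝ) ^ j ≤ 2 * (m + 1) := by
      have : (4 : ℝ) ^ j ≤ m + 2 := by exact_mod_cast h3
      linarith
    calc (m + 1 : ℝ) ^ σ * ((4 : ℝ) ^ j) ^ γ ≤ (m + 1 : ℝ) ^ σ * (2 * (m + 1)) ^ γ := by
          gcongr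
      _ = 2 ^ |γ| * (m + 1 : ℝ) ^ (σ + γ) := by
          rw [Real.mul_rpow two_pos.le (by positivity), abs_of_nonneg hγ,
            Real.rpow_add (by positivity)]
          ring
      _ ≤ _ := by gcongr
  · calc (m + 1 : ℝ) ^ σ * ((4 : ℝ) ^ j) ^ γ ≤ (m + 1 : ℝ) ^ ρ * 1 :=
          mul_le_mul (Real.rpow_le_rpow_of_exponent_le hM h1)
            (Real.rpow_le_one_of_one_le_of_nonpos h4j hγ) (by positivity) (by positivity)
      _ ≤ _ := by
          rw [mul_one]
          exact le_mul_of_one_le_left (by positivity)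
            (Real.one_le_rpow one_le_two (abs_nonneg γ))

theorem exists_sum_sq_midMass_le_rpow (hp : ∀ i, 0 < p i) (hsum : ∑ i, p i = 1) {Pm q : ℝ}
    (hPm : ∀ i, p i ≤ Pm) (hPm0 : 0 ≤ Pm) (hq0 : 0 < q) (hq : ∀ i, q ≤ p i) {θ σ ψ c ε : ℝ}
    (hθ : ∑ i, p i ^ θ = (∑ i, p i ^ 2) ^ 2) (hψ : ∑ i, p i ^ 2 = Real.exp (-ψ)) (hψ0 : 0 < ψ)
    (hσ0 : 0 ≤ σ) (hσ : Pm ^ σ ≤ (∑ i, p i ^ 2) ^ 2) (hσc : σ ≤ 2 * ψ * c)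
    (hθc : (3 + θ) / 2 ≤ 2 * ψ * c) (hc : 0 ≤ c) (hε : 0 < ε) {d : Fin k} (hd : ∀ i, i ≤ d) :
    ∃ C, 0 < C ∧ ∀ N K u m : ℕ, 2 ≤ K → Pm ^ K ≤ p d ^ 2 / N → (c + ε) * Real.log N ≤ K →
      m + 2 ≤ N → (u = 0 ∨ ∃ b : Str k K, ¬ beginsWith2 d b ∧ u = lexVal b) →
      ∑ j ∈ range (m + 1), (∑ b : Str k K with ¬ beginsWith2 d b ∧ u ≤ lexVal b,
        (m + 2 : ℝ) ^ 2 * m.choose j * (strP p b ^ 2 * midMass lexVal (strP p) u b ^ j *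
          tailMass lexVal (strP (K := K) p) (lexVal b) ^ (m - j))) ^ 2 ≤
      C * (N : ℝ) ^ (-(ψ * ε)) * tailMass lexVal (strP (K := K) p) u ^ (2 * (m + 2)) := by
  have hne : 0 < ∑ i, p i ^ 2 := by rw [hψ]; exact Real.exp_pos _
  have hβ : ∀ i, p i ^ θ / (∑ i, p i ^ 2) ^ 2 ≤ p i ^ (θ - σ) := by
    intro i
    rw [Real.rpow_sub (hp i)]
    have h1 : p i ^ σ ≤ (∑ i, p i ^ 2) ^ 2 :=
      (Real.rpow_le_rpow (hp i).le (hPm i) hσ0).trans hσ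
    exact div_le_div_of_nonneg_left (Real.rpow_nonneg (hp i).le _)
      (Real.rpow_pos_of_pos (hp i) _) h1
  obtain ⟨C, hC, H⟩ := sum_sq_midMass_le hp hsum hPm hPm0 hq0 hq hθ hβ hd
  set γ := (3 - θ) / 2 + (θ - σ) with hγ
  set κ := p d ^ 2 with hκ
  have hκ0 : 0 < κ := pow_pos (hp d) 2
  have he : 0 < ψ * ε := by positivity
  have hlog2 := Real.log_pos one_lt_two
  refine ⟨16 * C / κ ^ σ * 2 ^ |γ| * (1 / (ψ * ε * Real.log 2) + 1), by positivity,
    fun N K u m hK hPK hcK hmN hu => ?_⟩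
  have hM : (0 : ℝ) < m + 1 := by positivity
  have hMN : (m + 1 : ℝ) ≤ N := by exact_mod_cast (by omega : m + 1 ≤ N)
  have hN0 : (0 : ℝ) < N := hM.trans_le hMN
  obtain ⟨hW, hsq⟩ := H K u m hK (hPK.trans (by gcongr)) hu
  refine hsq.trans ?_
  set W := tailMass lexVal (strP (K := K) p) u with hWdef
  have hW0 : 0 < W := hκ0.trans_le hW
  set S := ∑ j ∈ range (Nat.log 2 (Nat.sqrt (m + 2)) + 1), ((4 : ℝ) ^ j) ^ γ with hS
  have hS1 : (m + 1 : ℝ) ^ σ * S ≤ 2 ^ |γ| * (N : ℝ) ^ (2 * ψ * c) *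
      ((1 / (ψ * ε * Real.log 2) + 1) * (N : ℝ) ^ (ψ * ε)) := by
    calc (m + 1 : ℝ) ^ σ * S
        ≤ ∑ j ∈ range (Nat.log 2 (Nat.sqrt (m + 2)) + 1),
            2 ^ |γ| * (m + 1 : ℝ) ^ (2 * ψ * c) := by
          rw [hS, mul_sum]
          refine sum_le_sum fun j hj => rpow_mul_four_pow_rpow_le hσc ?_
            (Nat.lt_succ_iff.1 (mem_range.1 hj))
          rw [hγ]
          linarith
      _ = 2 ^ |γ| * (m + 1 : ℝ) ^ (2 * ψ * c) *
            ((Nat.log 2 (Nat.sqrt (m + 2)) : ℝ) + 1) := by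
          rw [sum_const, card_range, nsmul_eq_mul]
          push_cast
          ring
      _ ≤ _ := by
          gcongr
          exact natLog_sqrt_add_one_le he hmN
  have hφK : (∑ i, p i ^ 2) ^ (2 * K) ≤ (N : ℝ) ^ (-(2 * ψ * c) - 2 * (ψ * ε)) := by
    rw [hψ, ← Real.exp_nat_mul, Real.rpow_def_of_pos hN0, Real.exp_le_exp]
    push_cast
    nlinarith
  have hWM : (W / (m + 1)) ^ (4 - θ + (θ - σ)) ≤
      W ^ 4 / (m + 1) ^ 4 * ((m + 1 : ℝ) ^ σ / κ ^ σ) := by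
    rw [show 4 - θ + (θ - σ) = (4 : ℕ) - σ by push_cast; ring, Real.rpow_sub (by positivity),
      Real.rpow_natCast, div_pow, div_eq_mul_inv _ ((W / (m + 1)) ^ σ),
      Real.div_rpow hW0.le hM.le, inv_div]
    gcongr
  have hm4 : (m + 2 : ℝ) ^ 4 ≤ 16 * (m + 1) ^ 4 := by
    have h1 : (m + 2 : ℝ) ≤ 2 * (m + 1) := by
      have : (0 : ℝ) ≤ m := Nat.cast_nonneg m
      linarith
    calc (m + 2 : ℝ) ^ 4 ≤ (2 * (m + 1)) ^ 4 := by gcongr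
      _ = _ := by ring
  have hS0 : 0 ≤ S := sum_nonneg fun j _ => by positivity
  have hpow : (N : ℝ) ^ (-(2 * ψ * c) - 2 * (ψ * ε)) * ((N : ℝ) ^ (2 * ψ * c) *
      (N : ℝ) ^ (ψ * ε)) = (N : ℝ) ^ (-(ψ * ε)) := by
    rw [← Real.rpow_add hN0, ← Real.rpow_add hN0]
    congr 1
    ring
  calc (m + 2 : ℝ) ^ 4 * W ^ (2 * m) * (C * (∑ i, p i ^ 2) ^ (2 * K) *
        (W / (m + 1)) ^ (4 - θ + (θ - σ)) * S)
      ≤ 16 * (m + 1) ^ 4 * W ^ (2 * m) * (C * (N : ℝ) ^ (-(2 * ψ * c) - 2 * (ψ * ε)) *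
        (W ^ 4 / (m + 1) ^ 4 * ((m + 1 : ℝ) ^ σ / κ ^ σ)) * S) := by
        gcongr
    _ = 16 * C / κ ^ σ * W ^ (2 * (m + 2)) * (N : ℝ) ^ (-(2 * ψ * c) - 2 * (ψ * ε)) *
        ((m + 1 : ℝ) ^ σ * S) := by
        rw [show 2 * (m + 2) = 2 * m + 4 by ring, pow_add]
        field_simp
    _ ≤ 16 * C / κ ^ σ * W ^ (2 * (m + 2)) * (N : ℝ) ^ (-(2 * ψ * c) - 2 * (ψ * ε)) *
        (2 ^ |γ| * (N : ℝ) ^ (2 * ψ * c) *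
          ((1 / (ψ * ε * Real.log 2) + 1) * (N : ℝ) ^ (ψ * ε))) := by
        gcongr
    _ = 16 * C / κ ^ σ * 2 ^ |γ| * (1 / (ψ * ε * Real.log 2) + 1) *
        ((N : ℝ) ^ (-(2 * ψ * c) - 2 * (ψ * ε)) * ((N : ℝ) ^ (2 * ψ * c) *
          (N : ℝ) ^ (ψ * ε))) * W ^ (2 * (m + 2)) := by ring
    _ = _ := by rw [hpow]

theorem sum_seqP (hsum : ∑ i, p i = 1) (N K : ℕ) :
    ∑ ω : Fin N → Str k K, seqP p ω = 1 := by
  simp only [seqP]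
  rw [← Fintype.piFinset_univ, ← prod_univ_sum (fun _ => univ) (fun (_ : Fin N) s => strP p s)]
  simp [sum_strP hsum]

theorem card_edgesAvoiding_le {N K : ℕ} (d : Fin k) (s : Fin N → Str k K) :
    #(edgesAvoiding d s) ≤ N := by
  refine (card_le_card_of_injOn Prod.fst (fun _ _ => mem_coe.2 (mem_univ _)) ?_).trans
    (card_fin N).le
  intro e he e' he' h
  have h1 := (mem_filter.1 (mem_filter.1 he).1).2.1
  have h2 := (mem_filter.1 (mem_filter.1 he').1).2.1
  refine Prod.ext h (Fin.ext ?_)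
  rw [h1, h2, h]

theorem expMoment_le_exp (hp : ∀ i, 0 < p i) (hsum : ∑ i, p i = 1) (d : Fin k) {t : ℝ}
    (ht : 0 < t) (N K : ℕ) :
    ∑ ω : Fin N → Str k K, ∑ ω' : Fin N → Str k K, seqP p ω * seqP p ω' *
      Real.exp (t * ((edgesAvoiding d (sortedSeq ω) ∩ edgesAvoiding d (sortedSeq ω')).card : ℝ))
      ≤ Real.exp (t * N) := by
  have hs : ∀ ω : Fin N → Str k K, 0 ≤ seqP p ω := fun ω =>
    prod_nonneg fun i _ => prod_nonneg fun j _ => (hp _).le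
  calc _ ≤ ∑ ω : Fin N → Str k K, ∑ ω' : Fin N → Str k K,
        seqP p ω * seqP p ω' * Real.exp (t * N) := by
        refine sum_le_sum fun ω _ => sum_le_sum fun ω' _ =>
          mul_le_mul_of_nonneg_left ?_ (mul_nonneg (hs ω) (hs ω'))
        have h1 := (card_le_card inter_subset_left).trans (card_edgesAvoiding_le d (sortedSeq ω))
          (a := #(edgesAvoiding d (sortedSeq ω) ∩ edgesAvoiding d (sortedSeq ω')))
        gcongr
    _ = (∑ ω : Fin N → Str k K, seqP p ω) * (∑ ω' : Fin N → Str k K, seqP p ω') *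
        Real.exp (t * N) := by
        simp only [sum_mul, mul_sum]
        exact sum_comm
    _ = _ := by rw [sum_seqP hsum, one_mul, one_mul]

theorem eventually_length_bounds {lam c ε κ : ℝ} (hlam : 0 < lam) (hc : 1 / lam ≤ c)
    (hε : 0 < ε) (hκ : 0 < κ) :
    ∀ᶠ N : ℕ in Filter.atTop, ∀ K : ℕ, (c + ε) * Real.log N ≤ K →
      2 ≤ K ∧ Real.exp (-lam) ^ K ≤ κ / N := by
  have h1 : ∀ᶠ N : ℕ in Filter.atTop, (N : ℝ) ^ (-(lam * ε)) ≤ κ :=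
    ((tendsto_rpow_neg_atTop (by positivity)).comp tendsto_natCast_atTop_atTop).eventually_le_const
      hκ
  have h2 : ∀ᶠ N : ℕ in Filter.atTop, 2 / ε ≤ Real.log N :=
    (Real.tendsto_log_atTop.comp tendsto_natCast_atTop_atTop).eventually_ge_atTop _
  filter_upwards [h1, h2, Filter.eventually_ge_atTop 1] with N h1 h2 h3 K hK
  have hN : (0 : ℝ) < N := by exact_mod_cast h3
  have hlog : 0 ≤ Real.log N := Real.log_nonneg (by exact_mod_cast h3)
  have hc0 : 0 ≤ c := (one_div_pos.2 hlam).le.trans hc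
  constructor
  · rw [div_le_iff₀ hε] at h2
    have : (2 : ℝ) ≤ K := by nlinarith
    exact_mod_cast this
  · have h4 : 1 ≤ lam * c := by
      rw [div_le_iff₀ hlam] at hc
      linarith
    calc Real.exp (-lam) ^ K ≤ (N : ℝ) ^ (-(lam * ε) - 1) := by
          rw [← Real.exp_nat_mul, Real.rpow_def_of_pos hN, Real.exp_le_exp]
          have h5 := mul_le_mul_of_nonneg_left hK hlam.le
          nlinarith
      _ = (N : ℝ) ^ (-(lam * ε)) / N := Real.rpow_sub_one hN.ne' _
      _ ≤ κ / N := by gcongr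

end Rate

/-- **Lemma (exponential moment of forward shared edges)**: for every `p`, `ε > 0`, `t > 0`
there are `δ > 0` and a constant `A` such that whenever `K ≥ (C̄_p + ε) log N`,
`E[exp(t |E_forward(G,G')|)] ≤ 1 + A N^{-δ}` for the shuffle graphs `G, G'` of two
independent `p`-random sequences of `N` strings of length `K`. -/
theorem expMoment_forward_edges (k : ℕ) (hk : 2 ≤ k) (p : Fin k → ℝ)
    (hpos : ∀ i, 0 < p i) (hsum : ∑ i, p i = 1)
    (θ : ℝ) (hθ : phi p θ = (phi p 2) ^ 2)
    (ε t : ℝ) (hε : 0 < ε) (ht : 0 < t) :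
    ∃ δ : ℝ, 0 < δ ∧ ∃ A : ℝ, ∀ N K : ℕ,
      (Cbar p θ + ε) * Real.log N ≤ (K : ℝ) →
      ∑ ω : Fin N → Str k K, ∑ ω' : Fin N → Str k K,
          seqP p ω * seqP p ω' *
            Real.exp (t * ((edgesAvoiding ⟨k - 1, by omega⟩ (sortedSeq ω) ∩
                edgesAvoiding ⟨k - 1, by omega⟩ (sortedSeq ω')).card : ℝ))
        ≤ 1 + A * (N : ℝ) ^ (-δ) := by
  set d : Fin k := ⟨k - 1, by omega⟩ with hd
  have hdmax : ∀ i, i ≤ d := fun i => Fin.le_def.2 (by rw [hd]; simp only; omega)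
  have hne : Nonempty (Fin k) := ⟨d⟩
  have hPm : ∀ i, p i ≤ pmax p := fun i => le_ciSup (Set.finite_range p).bddAbove i
  have hPm0 : 0 < pmax p := (hpos d).trans_le (hPm d)
  have hlt1 : ∀ i, p i < 1 := by
    intro i
    have : Nontrivial (Fin k) := Fin.nontrivial_iff_two_le.2 hk
    obtain ⟨j, hj⟩ := exists_ne i
    have h1 := add_le_sum (fun a _ => (hpos a).le) (mem_univ i) (mem_univ j) hj.symm
    rw [hsum] at h1
    have := hpos j
    linarith
  have hPm1 : pmax p < 1 := by
    obtain ⟨i, hi⟩ := exists_eq_ciSup_of_finite (f := p)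
    rw [pmax, ← hi]
    exact hlt1 i
  obtain ⟨i₀, hi₀⟩ := Finite.exists_min p
  have hphi2 : phi p 2 = ∑ i, p i ^ 2 := by simp only [phi, Real.rpow_two]
  have hφ0 : 0 < phi p 2 := by
    rw [hphi2]
    exact sum_pos (fun i _ => pow_pos (hpos i) 2) ⟨d, mem_univ d⟩
  have hφ1 : phi p 2 < 1 := by
    rw [hphi2, ← hsum]
    refine sum_lt_sum_of_nonempty ⟨d, mem_univ d⟩ fun i _ => ?_
    have := hpos i
    have := hlt1 i
    nlinarith
  have hψ0 : 0 < psi p 2 := by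
    have := Real.log_neg hφ0 hφ1
    rw [psi]
    linarith
  set ψ := psi p 2 with hψ
  have hψexp : phi p 2 = Real.exp (-ψ) := by rw [hψ, psi, neg_neg, Real.exp_log hφ0]
  set lam := Real.log (1 / pmax p) with hlam
  have hlam0 : 0 < lam := Real.log_pos (by rwa [one_lt_div hPm0])
  have hPmexp : pmax p = Real.exp (-lam) := by
    rw [hlam, one_div, Real.log_inv, neg_neg, Real.exp_log hPm0]
  have hCt : 1 / lam ≤ Cbar p θ := le_max_left _ _
  have hCm : (3 + θ) / (4 * ψ) ≤ Cbar p θ := le_max_right _ _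
  have hC0 : 0 < Cbar p θ := (one_div_pos.2 hlam0).trans_le hCt
  obtain ⟨C, hC, H⟩ := exists_sum_sq_midMass_le_rpow (Pm := pmax p) (q := p i₀) (θ := θ)
    (σ := 2 * ψ * (1 / lam)) (ψ := ψ) (c := Cbar p θ) (ε := ε) (d := d)
    hpos hsum hPm hPm0.le (hpos i₀) hi₀ (by rw [← hphi2, ← hθ, phi]) (by rw [← hphi2, hψexp]) hψ0
    (by positivity) (by
      rw [← hphi2, hψexp, hPmexp, ← Real.exp_mul, ← Real.exp_nat_mul]
      refine le_of_eq ?_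
      congr 1
      push_cast
      field_simp) (by gcongr) (by
      rw [div_le_iff₀ (by positivity)] at hCm
      linarith) hC0.le hε hdmax
  set δ := ψ * ε with hδ
  have hδ0 : 0 < δ := by positivity
  have hexp : 0 < Real.exp (2 * t) - 1 := sub_pos.2 (Real.one_lt_exp_iff.2 (by positivity))
  set D := (Real.exp (2 * t) - 1) * C with hD
  have hD0 : 0 < D := by positivity
  have hev : ∀ᶠ N : ℕ in Filter.atTop, D * (N : ℝ) ^ (-δ) ≤ 1 / 2 := by
    have h1 := ((tendsto_rpow_neg_atTop hδ0).comp tendsto_natCast_atTop_atTop).const_mul D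
    rw [mul_zero] at h1
    exact h1.eventually_le_const (by norm_num)
  obtain ⟨N₀, hN₀⟩ := Filter.eventually_atTop.1
    (hev.and (eventually_length_bounds hlam0 hCt hε (pow_pos (hpos d) 2)))
  refine ⟨δ, hδ0, 2 * D + Real.exp (t * N₀) * (N₀ : ℝ) ^ δ, fun N K hNK => ?_⟩
  have hrpow : 0 ≤ (N : ℝ) ^ (-δ) := by positivity
  rcases le_or_gt N₀ N with hN | hN
  · obtain ⟨hQ, hlen⟩ := hN₀ N hN
    obtain ⟨hK2, hPK⟩ := hlen K hNK
    rw [← hPmexp] at hPK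
    have h1 := expMoment_le (N := N) (K := K) hpos hsum d ht (Q := D * (N : ℝ) ^ (-δ))
      (by positivity) hQ fun u m hu hm => by
        refine (mul_le_mul_of_nonneg_left (H N K u m hK2 hPK hNK hm hu) hexp.le).trans
          (le_of_eq ?_)
        rw [hD]
        ring
    have h2 : 0 ≤ Real.exp (t * N₀) * (N₀ : ℝ) ^ δ * (N : ℝ) ^ (-δ) := by positivity
    linarith
  · have h1 := expMoment_le_exp (K := K) hpos hsum d ht N
    have h2 : 0 ≤ 2 * D * (N : ℝ) ^ (-δ) := by positivity
    rcases Nat.eq_zero_or_pos N with rfl | hN1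
    · refine h1.trans ?_
      rw [Nat.cast_zero, mul_zero, Real.exp_zero, Real.zero_rpow (by linarith)]
      simp
    · have hN1' : (0 : ℝ) < N := by exact_mod_cast hN1
      have hNN : (N : ℝ) ≤ N₀ := by exact_mod_cast hN.le
      have h3 : 1 ≤ (N₀ : ℝ) ^ δ * (N : ℝ) ^ (-δ) := by
        rw [Real.rpow_neg hN1'.le, ← div_eq_mul_inv, one_le_div (by positivity)]
        gcongr
      have h4 : Real.exp (t * N) ≤ Real.exp (t * N₀) := by gcongr
      have h5 := mul_le_mul_of_nonneg_left h3 (Real.exp_pos (t * N₀)).le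
      linarith

end RiffleShuffle
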